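/- arXiv:1708.02370 — 6 statements merged into one kernel-verified Lean document; each statement's English description precedes it below -/
import Mathlib

section
/- For all integers k ≥ 1 and c ≥ 1, the graph C(k,c) admits no (k−1)-colouring with clustering c. -/
/-- `G` is `k`-colourable with clustering `c`: the vertices can be coloured with `k`
colours so that every monochromatic component has at most `c` vertices. -/
def ClusteredColourable {V : Type*} (G : SimpleGraph V) (k c : ℕ) : Prop :=
  ∃ f : V → Fin k, ∀ v : V,
    ((G.induce {u | f u = f v}).connectedComponentMk ⟨v, rfl⟩).supp.ncard ≤ c

/-- `H` is a minor of `G`: there are pairwise disjoint connected branch sets in `G`,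
one for each vertex of `H`, with an edge of `G` between the branch sets of any two
vertices adjacent in `H`. -/
def IsMinor {α : Type*} {β : Type*} (H : SimpleGraph α) (G : SimpleGraph β) : Prop :=
  ∃ X : α → Set β,
    (∀ a, (G.induce (X a)).Connected) ∧
    (Pairwise fun a b => Disjoint (X a) (X b)) ∧
    (∀ a b, H.Adj a b → ∃ x ∈ X a, ∃ y ∈ X b, G.Adj x y)

/-- A copy of `H` is a subgraph of `G`. -/
def IsSubgraphEmb {α : Type*} {β : Type*} (H : SimpleGraph α) (G : SimpleGraph β) : Prop :=
  ∃ f : α → β, Function.Injective f ∧ ∀ a b, H.Adj a b → G.Adj (f a) (f b)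

/-- `closureTree h k` is the closure `C(h,k)` of the complete `k`-ary tree of depth `h`:
vertices are the nodes of the tree (sequences over `Fin k` of length `< h`), and two
distinct nodes are adjacent iff one is an ancestor (i.e. a prefix) of the other. -/
def closureTree (h k : ℕ) : SimpleGraph {l : List (Fin k) // l.length < h} :=
  SimpleGraph.fromRel (fun u v => u.1 <+: v.1)

/-- `weakClosureTree h k` is the weak closure `W(h,k)` of the complete `k`-ary tree of
depth `h`: two nodes are adjacent iff one is a leaf (a node of depth `h`, i.e. a sequence
of length `h - 1`) and the other is a proper ancestor (prefix) of it. -/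
def weakClosureTree (h k : ℕ) : SimpleGraph {l : List (Fin k) // l.length < h} :=
  SimpleGraph.fromRel (fun u v => v.1.length = h - 1 ∧ u.1 <+: v.1)

/-- The connected tree-depth of a finite graph `H`: the least depth of a rooted tree
whose closure contains `H` as a subgraph.  (It suffices to consider complete `n`-ary
trees where `n` is the number of vertices of `H`.) -/
noncomputable def ctd {V : Type*} [Finite V] (H : SimpleGraph V) : ℕ :=
  sInf {h : ℕ | IsSubgraphEmb H (closureTree h (Nat.card V))}

/-- The tree-depth of a finite graph `H`: the maximum over the connected components of
`H` of the connected tree-depth of that component. -/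
noncomputable def treeDepth {V : Type*} [Finite V] (H : SimpleGraph V) : ℕ :=
  sSup {n : ℕ | ∃ C : H.ConnectedComponent, n = ctd (H.induce C.supp)}

/-- The `n`-fan: a path on `n` vertices plus one dominant vertex. -/
def fan (n : ℕ) : SimpleGraph (Option (Fin n)) :=
  SimpleGraph.fromRel (fun u v =>
    match u, v with
    | none, some _ => True
    | some i, some j => (i : ℕ) + 1 = (j : ℕ)
    | _, _ => False)

/-- The `n`-fat star: a star with centre `Sum.inl ()` and `n` leaves, where for each
edge from the centre to leaf `i` there are `n` extra vertices `(i, j)` adjacent to both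
the centre and leaf `i`. -/
def fatStar (n : ℕ) : SimpleGraph (Unit ⊕ Fin n ⊕ Fin n × Fin n) :=
  SimpleGraph.fromRel (fun u v =>
    match u, v with
    | Sum.inl _, Sum.inr _ => True
    | Sum.inr (Sum.inl i), Sum.inr (Sum.inr (i', _)) => i = i'
    | _, _ => False)

/-- The `n`-fat path: a path on `n` vertices, where for each edge `{e, e+1}` of the path
there are `n` extra vertices `(e, j)` adjacent to both endpoints of that edge. -/
def fatPath (n : ℕ) : SimpleGraph (Fin n ⊕ Fin (n - 1) × Fin n) :=
  SimpleGraph.fromRel (fun u v =>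
    match u, v with
    | Sum.inl i, Sum.inl j => (i : ℕ) + 1 = (j : ℕ)
    | Sum.inl i, Sum.inr (e, _) => (i : ℕ) = (e : ℕ) ∨ (i : ℕ) = (e : ℕ) + 1
    | _, _ => False)

/-- `G` has treewidth at most `w`: there is a tree decomposition of `G` all of whose
bags have at most `w + 1` vertices. -/
def HasTreewidthAtMost {V : Type*} (G : SimpleGraph V) (w : ℕ) : Prop :=
  ∃ (ι : Type) (T : SimpleGraph ι) (B : ι → Set V),
    T.Connected ∧ T.IsAcyclic ∧
    (∀ v : V, ∃ t, v ∈ B t) ∧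
    (∀ u v : V, G.Adj u v → ∃ t, u ∈ B t ∧ v ∈ B t) ∧
    (∀ v : V, (T.induce {t | v ∈ B t}).Connected) ∧
    (∀ t, (B t).ncard ≤ w + 1)

/-- A `k`-strong `H`-model in `G`: pairwise disjoint connected subgraphs `X a` of `G`,
one for each vertex `a` of `H`, such that for every edge `ab` of `H` at least `k`
vertices of `G` outside all the `X`'s have neighbours in both `X a` and `X b`. -/
def StrongModel {α : Type*} {β : Type*} (k : ℕ) (H : SimpleGraph α) (G : SimpleGraph β) : Prop :=
  ∃ X : α → Set β,
    (∀ a, (G.induce (X a)).Connected) ∧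
    (Pairwise fun a b => Disjoint (X a) (X b)) ∧
    (∀ a b, H.Adj a b →
      k ≤ {v : β | (∀ x, v ∉ X x) ∧ (∃ x ∈ X a, G.Adj v x) ∧ (∃ y ∈ X b, G.Adj v y)}.ncard)

/-- If every monochromatic component has at most `c` vertices, then every internal node `l` has a
child whose subtree avoids the colour of `l`. -/
lemma exists_child_avoiding_colour {h c : ℕ} {α : Type*}
    (f : {l : List (Fin c) // l.length < h} → α)
    (hf : ∀ v, (((closureTree h c).induce {u | f u = f v}).connectedComponentMk
      ⟨v, rfl⟩).supp.ncard ≤ c)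
    (l : {l : List (Fin c) // l.length < h}) :
    ∃ i : Fin c, ∀ v, l.1 ++ [i] <+: v.1 → f v ≠ f l := by
  by_contra! hcon
  choose v hpre hcol using hcon
  have hfin : Finite {l : List (Fin c) // l.length < h} := List.finite_length_lt (Fin c) h
  have hne : ∀ i, l ≠ v i := fun i hi => by
    have := (hpre i).length_le
    rw [← hi] at this
    simp at this
  have hinj : Function.Injective v := fun i j hij => by
    have hj := hpre j
    rw [← hij] at hj
    have := (List.prefix_of_prefix_length_le (hpre i) hj (by simp)).eq_of_length (by simp)
    simpa using this
  let g : Option (Fin c) → {u | f u = f l} := fun o => o.elim ⟨l, rfl⟩ fun i => ⟨v i, hcol i⟩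
  have hg : Function.Injective g := by
    rintro (_ | i) (_ | j) hij
    · rfl
    · exact absurd (congrArg Subtype.val hij) (hne j)
    · exact absurd (congrArg Subtype.val hij).symm (hne i)
    · exact congrArg some (hinj (congrArg Subtype.val hij))
  have hsub : Set.range g ⊆ (((closureTree h c).induce {u | f u = f l}).connectedComponentMk
      ⟨l, rfl⟩).supp := by
    rintro _ ⟨_ | i, rfl⟩
    · exact SimpleGraph.ConnectedComponent.connectedComponentMk_mem
    · refine SimpleGraph.ConnectedComponent.sound (SimpleGraph.Adj.reachable ?_)
      change (closureTree h c).Adj (v i) l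
      exact (SimpleGraph.fromRel_adj _ _ _).2
        ⟨(hne i).symm, Or.inr ((List.prefix_append _ _).trans (hpre i))⟩
  have hcard : (Set.range g).ncard = c + 1 := by
    rw [← Set.image_univ, Set.ncard_image_of_injective _ hg, Set.ncard_univ]
    simp
  have := (Set.ncard_le_ncard hsub (Set.toFinite _)).trans (hf l)
  omega

/-- In a colouring with clustering `c`, at each depth some node has a subtree avoiding as many
colours as the node has proper ancestors. -/
lemma exists_subtree_avoiding_colours {h c : ℕ} {α : Type*}
    (f : {l : List (Fin c) // l.length < h} → α)
    (hf : ∀ v, (((closureTree h c).induce {u | f u = f v}).connectedComponentMk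
      ⟨v, rfl⟩).supp.ncard ≤ c) (j : ℕ) (hj : j < h) :
    ∃ l : {l : List (Fin c) // l.length < h}, l.1.length = j ∧
      ∃ S : Finset α, S.card = j ∧ ∀ v, l.1 <+: v.1 → f v ∉ S := by
  classical
  induction j with
  | zero => exact ⟨⟨[], hj⟩, rfl, ∅, rfl, by simp⟩
  | succ j ih =>
    obtain ⟨l, hl, S, hS, hav⟩ := ih (by omega)
    obtain ⟨i, hi⟩ := exists_child_avoiding_colour f hf l
    refine ⟨⟨l.1 ++ [i], by simpa [hl] using hj⟩, by simp [hl], insert (f l) S, ?_, ?_⟩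
    · rw [Finset.card_insert_of_notMem (hav l List.prefix_rfl), hS]
    · intro v hv
      rw [Finset.mem_insert, not_or]
      exact ⟨hi v hv, hav v ((List.prefix_append _ _).trans hv)⟩

/-- For all `k ≥ 1` and `c ≥ 1`, the closure `C(k,c)` of the complete
`c`-ary tree of depth `k` has no `(k-1)`-colouring with clustering `c`. -/
theorem closureTree_not_clustered_colourable (k c : ℕ) (hk : 1 ≤ k) (hc : 1 ≤ c) :
    ¬ ClusteredColourable (closureTree k c) (k - 1) c := by
  rintro ⟨f, hf⟩
  obtain ⟨l, -, S, hS, hav⟩ := exists_subtree_avoiding_colours f hf (k - 1) (by omega)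
  have hSuniv : S = Finset.univ := Finset.eq_univ_of_card S (by simpa using hS)
  exact hav l List.prefix_rfl (hSuniv ▸ Finset.mem_univ _)
end

section
/- For all integers h, k, w ≥ 1, every C(h,k)-minor-free graph of treewidth at most w is (2^h − 2)-colourable with clustering kw. -/
namespace SimpleGraph

/-- A union of connected sets indexed by a connected graph is connected, provided that the sets
of adjacent indices have connected union. -/
theorem Connected.induce_iUnion {α β : Type*} {H : SimpleGraph α} {G : SimpleGraph β}
    (hH : H.Connected) {Z : α → Set β} (hZ : ∀ a, (G.induce (Z a)).Connected)
    (hadj : ∀ a b, H.Adj a b → (G.induce (Z a ∪ Z b)).Connected) :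
    (G.induce (⋃ a, Z a)).Connected := by
  obtain ⟨a₀⟩ := hH.nonempty
  obtain ⟨⟨x₀, hx₀⟩⟩ := (hZ a₀).nonempty
  have lift : ∀ {s : Set β} (hs : s ⊆ ⋃ a, Z a), (G.induce s).Connected →
      ∀ x y (hx : x ∈ s) (hy : y ∈ s),
        (G.induce (⋃ a, Z a)).Reachable ⟨x, hs hx⟩ ⟨y, hs hy⟩ := fun hs hc x y hx hy =>
    (hc.preconnected ⟨x, hx⟩ ⟨y, hy⟩).map (induceHomOfLE G hs).toHom
  have key : ∀ a b, H.Walk a b → ∀ x y (hx : x ∈ Z a) (hy : y ∈ Z b),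
      (G.induce (⋃ a, Z a)).Reachable ⟨x, Set.mem_iUnion_of_mem a hx⟩
        ⟨y, Set.mem_iUnion_of_mem b hy⟩ := by
    intro a b p
    induction p with
    | nil => exact fun x y hx hy => lift (Set.subset_iUnion _ _) (hZ _) x y hx hy
    | @cons a c b hac _ ih =>
      intro x y hx hy
      obtain ⟨⟨z, hz⟩⟩ := (hZ c).nonempty
      exact (lift (Set.union_subset (Set.subset_iUnion _ _) (Set.subset_iUnion _ _))
        (hadj a c hac) x z (Or.inl hx) (Or.inr hz)).trans (ih z y hz hy)
  rw [connected_iff_exists_forall_reachable]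
  refine ⟨⟨x₀, Set.mem_iUnion_of_mem a₀ hx₀⟩, ?_⟩
  rintro ⟨y, hy⟩
  obtain ⟨b, hb⟩ := Set.mem_iUnion.1 hy
  obtain ⟨p⟩ := hH.preconnected a₀ b
  exact key a₀ b p x₀ y hx₀ hb

/-- A function that is constant along the edges inside a connected set is constant on it. -/
theorem Connected.eq_of_forall_adj {V α : Type*} {G : SimpleGraph V} {W : Set V}
    (hW : (G.induce W).Connected) {f : V → α}
    (hf : ∀ u ∈ W, ∀ v ∈ W, G.Adj u v → f u = f v) {u v : V} (hu : u ∈ W) (hv : v ∈ W) :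
    f u = f v := by
  obtain ⟨p⟩ := hW.preconnected ⟨u, hu⟩ ⟨v, hv⟩
  have key : ∀ a b : W, (G.induce W).Walk a b → f a = f b := by
    intro a b p
    induction p with
    | nil => rfl
    | @cons a b c h _ ih => exact (hf a a.2 b b.2 h).trans ih
  exact key _ _ p

/-- A vertex at positive distance from `r` has a neighbour closer to `r` by one. -/
theorem Reachable.exists_adj_dist_eq {V : Type*} {G : SimpleGraph V} {r v : V} {n : ℕ}
    (h : G.Reachable r v) (hd : G.dist r v = n + 1) : ∃ u, G.Adj v u ∧ G.dist r u = n := by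
  obtain ⟨p, hp⟩ := h.symm.exists_walk_length_eq_dist
  rw [dist_comm, hd] at hp
  cases p with
  | nil => simp at hp
  | @cons _ u _ hvu q =>
    refine ⟨u, hvu, ?_⟩
    have h1 : G.dist r u ≤ n := by
      rw [dist_comm]
      exact (dist_le q).trans (by simpa using hp.le)
    obtain ⟨q', hq'⟩ := (q.reverse.reachable).exists_walk_length_eq_dist
    have h2 := dist_le (q'.concat hvu.symm)
    rw [Walk.length_concat, hd, hq'] at h2
    omega

/-- If a connected set in a tree rooted at `r` has highest node `t`, then `t` lies in every
connected set that meets it and contains a node at most as deep as `t`. -/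
theorem IsAcyclic.top_mem_of_inter {ι : Type*} {T : SimpleGraph ι} (ha : T.IsAcyclic)
    (hc : T.Connected) {r t s z : ι} {X Y : Set ι} (hX : (T.induce X).Connected)
    (hY : (T.induce Y).Connected) (htX : t ∈ X) (ht : ∀ x ∈ X, T.dist r t ≤ T.dist r x)
    (hzX : z ∈ X) (hzY : z ∈ Y) (hsY : s ∈ Y) (hs : T.dist r s ≤ T.dist r t) : t ∈ Y := by
  by_contra htY
  have hst : s ≠ t := fun h => htY (h ▸ hsY)
  obtain h0 | ⟨n, hn⟩ : T.dist r t = 0 ∨ ∃ n, T.dist r t = n + 1 := by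
    cases T.dist r t <;> simp
  · have h1 := (hc r t).dist_eq_zero_iff.1 h0
    have h2 := (hc r s).dist_eq_zero_iff.1 (by omega)
    exact hst (h2.symm.trans h1)
  obtain ⟨p, htp, hp⟩ := (hc r t).exists_adj_dist_eq hn
  have hpX : p ∉ X := fun h => by have := ht p h; omega
  have hbr := (isAcyclic_iff_forall_adj_isBridge.1 ha htp)
  rw [isBridge_iff] at hbr
  -- Nodes other than `t` that are at most as deep as `t` reach `r` without the edge `tp`.
  have up : ∀ m x, x ≠ t → T.dist r x = m → m ≤ T.dist r t →
      (T \ fromEdgeSet {s(t, p)}).Reachable r x := by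
    intro m
    induction m with
    | zero =>
      intro x _ hx _
      rw [(hc r x).dist_eq_zero_iff.1 hx]
    | succ m ih =>
      intro x hxt hx hm
      obtain ⟨u, hxu, hu⟩ := (hc r x).exists_adj_dist_eq hx
      have hut : u ≠ t := by rintro rfl; omega
      refine (ih u hut hu (by omega)).trans (Adj.reachable ?_)
      simp only [sdiff_adj, fromEdgeSet_adj, Set.mem_singleton_iff, Sym2.eq_iff]
      refine ⟨hxu.symm, ?_⟩
      tauto
  have inside : ∀ Z : Set ι, (T.induce Z).Connected → (t ∉ Z ∨ p ∉ Z) → ∀ x ∈ Z, ∀ y ∈ Z,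
      (T \ fromEdgeSet {s(t, p)}).Reachable x y := by
    intro Z hZ hne x hx y hy
    refine (hZ.preconnected ⟨x, hx⟩ ⟨y, hy⟩).map
      (⟨Subtype.val, ?_⟩ : T.induce Z →g T \ fromEdgeSet {s(t, p)})
    rintro ⟨a, haZ⟩ ⟨b, hbZ⟩ hab
    simp only [sdiff_adj, fromEdgeSet_adj, Set.mem_singleton_iff, Sym2.eq_iff]
    refine ⟨hab, ?_⟩
    rintro ⟨⟨rfl, rfl⟩ | ⟨rfl, rfl⟩, -⟩ <;> tauto
  apply hbr
  exact (inside X hX (Or.inr hpX) t htX z hzX).trans <|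
    (inside Y hY (Or.inl htY) z hzY s hsY).trans <|
    (up _ s hst rfl hs).symm.trans (up _ p htp.ne' rfl (by omega))

/-- Erdős–Pósa property of subtrees of a tree: a family of subtrees contains `k` pairwise disjoint
members or is hit by fewer than `k` nodes, each being the highest node of some member. -/
theorem IsAcyclic.exists_packing_or_hitting {ι α : Type*} [Finite α] {T : SimpleGraph ι}
    (ha : T.IsAcyclic) (hc : T.Connected) (r : ι) (X : α → Set ι) (k : ℕ) (F : Set α)
    (hX : ∀ a ∈ F, (T.induce (X a)).Connected) :
    (∃ g : Fin k → α, (∀ i, g i ∈ F) ∧ Pairwise fun i j => Disjoint (X (g i)) (X (g j))) ∨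
    ∃ S : Finset ι, S.card < k ∧ (∀ a ∈ F, ∃ t ∈ S, t ∈ X a) ∧
      ∀ t ∈ S, ∃ a ∈ F, t ∈ X a ∧ ∀ x ∈ X a, T.dist r t ≤ T.dist r x := by
  classical
  induction k generalizing F with
  | zero => exact Or.inl ⟨Fin.elim0, fun i => i.elim0, fun i => i.elim0⟩
  | succ k ih =>
    obtain rfl | hF := F.eq_empty_or_nonempty
    · exact Or.inr ⟨∅, by simp, by simp, by simp⟩
    have htop : ∀ a ∈ F, ∃ t ∈ X a, ∀ x ∈ X a, T.dist r t ≤ T.dist r x := by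
      intro a haF
      have hne : (X a).Nonempty := Set.nonempty_coe_sort.1 (hX a haF).nonempty
      obtain ⟨t, ht, hmin⟩ := WellFounded.has_min
        (InvImage.wf (fun x => T.dist r x) wellFounded_lt) (X a) hne
      exact ⟨t, ht, fun x hx => not_lt.1 (hmin x hx)⟩
    have : Nonempty ι := ⟨r⟩
    choose! t htX ht using htop
    obtain ⟨a₀, ha₀, hmax⟩ := F.exists_max_image (fun a => T.dist r (t a)) F.toFinite hF
    obtain ⟨g, hgF, hg⟩ | ⟨S, hS, hhit, htops⟩ :=
      ih {a ∈ F | t a₀ ∉ X a} (fun a h => hX a h.1)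
    · left
      have hdisj : ∀ i, Disjoint (X a₀) (X (g i)) := by
        refine fun i => Set.disjoint_left.2 fun z hz hz' => (hgF i).2 ?_
        exact ha.top_mem_of_inter hc (hX _ ha₀) (hX _ (hgF i).1) (htX _ ha₀) (ht _ ha₀) hz hz'
          (htX _ (hgF i).1) (hmax _ (hgF i).1)
      refine ⟨Fin.cons a₀ g, fun i => ?_, fun i j hij => ?_⟩
      · refine Fin.cases ?_ (fun i => ?_) i
        · simpa using ha₀
        · simpa using (hgF i).1
      · induction i using Fin.cases with
        | zero =>
          induction j using Fin.cases with
          | zero => exact absurd rfl hij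
          | succ j => simpa using hdisj j
        | succ i =>
          induction j using Fin.cases with
          | zero => simpa using (hdisj i).symm
          | succ j => simpa using hg (fun h => hij (by rw [h]))
    · right
      refine ⟨insert (t a₀) S, (Finset.card_insert_le _ _).trans_lt (by omega), ?_, ?_⟩
      · intro a haF
        by_cases h : t a₀ ∈ X a
        · exact ⟨_, Finset.mem_insert_self _ _, h⟩
        · obtain ⟨s, hs, hsa⟩ := hhit a ⟨haF, h⟩
          exact ⟨s, Finset.mem_insert_of_mem hs, hsa⟩
      · intro s hs
        obtain rfl | hs := Finset.mem_insert.1 hs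
        · exact ⟨a₀, ha₀, htX _ ha₀, ht _ ha₀⟩
        · obtain ⟨a, haF, h⟩ := htops s hs
          exact ⟨a, haF.1, h⟩

/-- Breadth-first layering of the components of `G[U]`: `ρ` gives the root of the component of a
vertex and `d` its distance to that root. -/
theorem exists_bfs_layering {V : Type*} (G : SimpleGraph V) (U : Set V) :
    ∃ (ρ : V → V) (d : V → ℕ),
      (∀ u ∈ U, ∀ v ∈ U, G.Adj u v → ρ u = ρ v ∧ d u ≤ d v + 1) ∧
      (∀ v, d v = 0 → v = ρ v) ∧
      (∀ v ∈ U, ∀ n, d v = n + 1 → ∃ u ∈ U, G.Adj v u ∧ ρ u = ρ v ∧ d u = n) := by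
  let H : SimpleGraph V :=
    { Adj u v := G.Adj u v ∧ u ∈ U ∧ v ∈ U
      symm := ⟨fun _ _ h => ⟨h.1.symm, h.2.2, h.2.1⟩⟩
      loopless := ⟨fun _ h => h.1.ne rfl⟩ }
  let ρ : V → V := fun v => (H.connectedComponentMk v).out
  have hρ : ∀ v, H.Reachable (ρ v) v := fun v => ConnectedComponent.exact (Quot.out_eq _)
  have hρ' : ∀ u v, H.Adj u v → ρ u = ρ v := fun u v h => by
    simp only [ρ, ConnectedComponent.sound h.reachable]
  refine ⟨ρ, fun v => H.dist (ρ v) v, ?_, ?_, ?_⟩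
  · intro u hu v hv huv
    have hH : H.Adj u v := ⟨huv, hu, hv⟩
    refine ⟨hρ' u v hH, ?_⟩
    obtain ⟨q, hq⟩ := (hρ v).exists_walk_length_eq_dist
    have := dist_le (q.concat hH.symm)
    rw [Walk.length_concat, hq] at this
    simpa only [hρ' u v hH] using this
  · exact fun v hv => ((hρ v).dist_eq_zero_iff.1 hv).symm
  · intro v _ n hn
    obtain ⟨u, hvu, hu⟩ := (hρ v).exists_adj_dist_eq hn
    exact ⟨u, hvu.2.2, hvu.1, (hρ' v u hvu).symm, by simpa only [← hρ' v u hvu] using hu⟩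

end SimpleGraph

/-- `H` has a minor model in `G` all of whose branch sets lie in `U`. -/
def HasModelIn {α β : Type*} (H : SimpleGraph α) (G : SimpleGraph β) (U : Set β) : Prop :=
  ∃ X : α → Set β,
    (∀ a, X a ⊆ U) ∧
    (∀ a, (G.induce (X a)).Connected) ∧
    (Pairwise fun a b => Disjoint (X a) (X b)) ∧
    (∀ a b, H.Adj a b → ∃ x ∈ X a, ∃ y ∈ X b, G.Adj x y)

theorem HasModelIn.mono {α β : Type*} {H : SimpleGraph α} {G : SimpleGraph β} {U U' : Set β}
    (h : HasModelIn H G U) (hU : U ⊆ U') : HasModelIn H G U' := by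
  obtain ⟨X, h1, h2⟩ := h
  exact ⟨X, fun a => (h1 a).trans hU, h2⟩

/-- A model of a connected graph can be found inside a connected set. -/
theorem HasModelIn.exists_connected {α β : Type*} {H : SimpleGraph α} {G : SimpleGraph β}
    {U : Set β} (hH : H.Connected) (h : HasModelIn H G U) :
    ∃ F ⊆ U, (G.induce F).Connected ∧ HasModelIn H G F := by
  obtain ⟨X, h1, h2, h3, h4⟩ := h
  refine ⟨⋃ a, X a, Set.iUnion_subset h1, hH.induce_iUnion h2 fun a b hab => ?_,
    X, Set.subset_iUnion X, h2, h3, h4⟩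
  obtain ⟨x, hx, y, hy, hxy⟩ := h4 a b hab
  exact SimpleGraph.connected_induce_union (h2 a).preconnected (h2 b).preconnected hx hy hxy

theorem closureTree_connected (h k : ℕ) : (closureTree (h + 1) k).Connected := by
  rw [SimpleGraph.connected_iff_exists_forall_reachable]
  refine ⟨⟨[], by simp⟩, fun v => ?_⟩
  by_cases hv : (⟨[], by simp⟩ : {l : List (Fin k) // l.length < h + 1}) = v
  · rw [hv]
  · exact SimpleGraph.Adj.reachable ⟨hv, Or.inl List.nil_prefix⟩

/-- Adding a connected set adjacent to every vertex of `k` disjoint models of `C(h,k)` yields a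
model of `C(h+1,k)`. -/
theorem hasModelIn_closureTree_succ {V : Type*} {G : SimpleGraph V} {h k : ℕ} {A W : Set V}
    (hA : (G.induce A).Connected) (hdisj : Disjoint A W) (hnb : ∀ v ∈ W, ∃ u ∈ A, G.Adj v u)
    (F : Fin k → Set V) (hF : ∀ i, F i ⊆ W) (hFd : Pairwise fun i j => Disjoint (F i) (F j))
    (hm : ∀ i, HasModelIn (closureTree h k) G (F i)) :
    HasModelIn (closureTree (h + 1) k) G (A ∪ W) := by
  choose X h1 h2 h3 h4 using hm
  let Z : {l : List (Fin k) // l.length < h + 1} → Set V := fun l =>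
    match l with
    | ⟨[], _⟩ => A
    | ⟨i :: l, hl⟩ => X i ⟨l, by simpa using hl⟩
  have hroot : ∀ i l, Disjoint A (X i l) := fun i l => hdisj.mono_right ((h1 i l).trans (hF i))
  have hpre : ∀ a b : {l : List (Fin k) // l.length < h + 1}, a ≠ b → a.1 <+: b.1 →
      ∃ x ∈ Z a, ∃ y ∈ Z b, G.Adj x y := by
    rintro ⟨_ | ⟨i, l⟩, hl⟩ ⟨_ | ⟨j, m⟩, hm⟩ hab hpre
    · exact absurd rfl hab
    · obtain ⟨⟨y, hy⟩⟩ := (h2 j ⟨m, by simpa using hm⟩).nonempty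
      obtain ⟨x, hx, hyx⟩ := hnb y (hF j (h1 j _ hy))
      exact ⟨x, hx, y, hy, hyx.symm⟩
    · simp at hpre
    · obtain ⟨rfl, hlm⟩ := List.cons_prefix_cons.1 hpre
      refine h4 i ⟨l, by simpa using hl⟩ ⟨m, by simpa using hm⟩ ⟨?_, Or.inl hlm⟩
      intro he
      apply hab
      simpa using he
  refine ⟨Z, ?_, ?_, ?_, ?_⟩
  · rintro ⟨_ | ⟨i, l⟩, hl⟩
    · exact Set.subset_union_left
    · exact ((h1 i _).trans (hF i)).trans Set.subset_union_right
  · rintro ⟨_ | ⟨i, l⟩, hl⟩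
    · exact hA
    · exact h2 i _
  · rintro ⟨_ | ⟨i, l⟩, hl⟩ ⟨_ | ⟨j, m⟩, hm⟩ hab
    · exact absurd rfl hab
    · exact hroot _ _
    · exact (hroot _ _).symm
    · by_cases hij : i = j
      · subst hij
        refine h3 i fun he => hab ?_
        simpa using he
      · exact (hFd hij).mono (h1 i _) (h1 j _)
  · rintro a b ⟨hab, hp | hp⟩
    · exact hpre a b hab hp
    · obtain ⟨x, hx, y, hy, hxy⟩ := hpre b a hab.symm hp
      exact ⟨y, hy, x, hx, hxy.symm⟩

/-- If every vertex of `W` has a neighbour in a connected set `A` disjoint from `W`, and there is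
no `C(h+1,k)` model in `A ∪ W`, then all `C(h,k)` models in `W` are hit by few vertices. -/
theorem exists_small_hitting_set {V : Type*} [Finite V] {G : SimpleGraph V} {h k w : ℕ}
    (hh : 1 ≤ h) (htw : HasTreewidthAtMost G w) {A W : Set V}
    (hA : (G.induce A).Connected) (hdisj : Disjoint A W) (hnb : ∀ v ∈ W, ∃ u ∈ A, G.Adj v u)
    (hmodel : ¬ HasModelIn (closureTree (h + 1) k) G (A ∪ W)) :
    ∃ S : Set V, S.ncard ≤ k * w ∧ ¬ HasModelIn (closureTree h k) G (W \ S) := by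
  obtain ⟨ι, T, B, hTc, hTa, hcov, hedge, hsub, hwidth⟩ := htw
  let N : Set V → Set ι := fun F => ⋃ v : F, {t | (v : V) ∈ B t}
  have hN : ∀ F : Set V, (G.induce F).Connected → (T.induce (N F)).Connected := by
    refine fun F hF => hF.induce_iUnion (fun v => hsub v) fun u v huv => ?_
    obtain ⟨t, htu, htv⟩ := hedge u v huv
    exact SimpleGraph.induce_union_connected (hsub u).preconnected (hsub v).preconnected
      ⟨t, htu, htv⟩
  have hmemN : ∀ F t, t ∈ N F ↔ ∃ v ∈ F, v ∈ B t := fun F t => by simp [N]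
  obtain ⟨⟨r, hr⟩⟩ := (hN A hA).nonempty
  obtain ⟨F, hF, hFd⟩ | ⟨S, hS, hhit, htop⟩ := hTa.exists_packing_or_hitting hTc r N k
    {F | F ⊆ W ∧ (G.induce F).Connected ∧ HasModelIn (closureTree h k) G F}
    (fun F hF => hN F hF.2.1)
  · refine absurd (hasModelIn_closureTree_succ hA hdisj hnb F (fun i => (hF i).1) ?_
      fun i => (hF i).2.2) hmodel
    refine fun i j hij => Set.disjoint_left.2 fun v hv hv' => ?_
    obtain ⟨t, ht⟩ := hcov v
    exact Set.disjoint_left.1 (hFd hij) ((hmemN _ _).2 ⟨v, hv, ht⟩) ((hmemN _ _).2 ⟨v, hv', ht⟩)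
  · have hbag : ∀ t ∈ S, (B t ∩ W).ncard ≤ w := by
      intro t ht
      obtain ⟨F, ⟨hFW, hFc, -⟩, htF, hmin⟩ := htop t ht
      obtain ⟨⟨v, hv⟩⟩ := hFc.nonempty
      obtain ⟨u, hu, hvu⟩ := hnb v (hFW hv)
      obtain ⟨z, hzv, hzu⟩ := hedge v u hvu
      have htA : t ∈ N A := hTa.top_mem_of_inter hTc (hN F hFc) (hN A hA) htF hmin
        ((hmemN _ _).2 ⟨v, hv, hzv⟩) ((hmemN _ _).2 ⟨u, hu, hzu⟩) hr (by simp)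
      obtain ⟨a, haA, hat⟩ := (hmemN _ _).1 htA
      have hlt : (B t ∩ W).ncard < (B t).ncard := by
        refine Set.ncard_lt_ncard ⟨Set.inter_subset_left, fun hle => ?_⟩ (Set.toFinite _)
        exact Set.disjoint_left.1 hdisj haA (hle hat).2
      have := hwidth t
      omega
    refine ⟨⋃ t ∈ S, B t ∩ W, ?_, fun hm => ?_⟩
    · calc (⋃ t ∈ S, B t ∩ W).ncard ≤ ∑ t ∈ S, (B t ∩ W).ncard := Finset.set_ncard_biUnion_le _ _
        _ ≤ S.card * w := by simpa using Finset.sum_le_card_nsmul S _ w hbag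
        _ ≤ k * w := Nat.mul_le_mul_right _ hS.le
    · obtain ⟨n, rfl⟩ : ∃ n, h = n + 1 := ⟨h - 1, by omega⟩
      obtain ⟨F, hFW, hFc, hFm⟩ := hm.exists_connected (closureTree_connected n k)
      obtain ⟨t, htS, htF⟩ := hhit F ⟨hFW.trans Set.sdiff_subset, hFc, hFm⟩
      obtain ⟨v, hvF, hvt⟩ := (hmemN _ _).1 htF
      exact (hFW hvF).2 (Set.mem_biUnion htS ⟨hvt, (hFW hvF).1⟩)

/-- `f` colours `U` with colours below `m` so that connected monochromatic subsets of `U` have at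
most `c` vertices. -/
def IsClusteredOn {V : Type*} (G : SimpleGraph V) (U : Set V) (m c : ℕ) (f : V → ℕ) : Prop :=
  (∀ v ∈ U, f v < m) ∧
  ∀ W ⊆ U, (G.induce W).Connected → (∀ u ∈ W, ∀ v ∈ W, f u = f v) → W.ncard ≤ c

/-- Colouring a set of at most `c` vertices with one extra colour. -/
theorem IsClusteredOn.extend {V : Type*} [Finite V] {G : SimpleGraph V} {W S : Set V} {m c : ℕ}
    {f : V → ℕ} (hf : IsClusteredOn G (W \ S) m c f) (hS : S.ncard ≤ c) :
    ∃ g, IsClusteredOn G W (m + 1) c g := by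
  classical
  refine ⟨fun v => if v ∈ S then m else f v, fun v hv => ?_, fun Y hY hYc hmono => ?_⟩
  · by_cases hvS : v ∈ S
    · simp [hvS]
    · simpa [hvS] using (hf.1 v ⟨hv, hvS⟩).trans (Nat.lt_succ_self m)
  · by_cases hYS : ∃ y ∈ Y, y ∈ S
    · obtain ⟨y, hy, hyS⟩ := hYS
      refine (Set.ncard_le_ncard (fun v hv => ?_) (Set.toFinite S)).trans hS
      by_contra hvS
      have h1 := hmono v hv y hy
      have h2 := hf.1 v ⟨hY hv, hvS⟩
      simp only [hvS, hyS, if_true, if_false] at h1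
      omega
    · have hYS' : ∀ y ∈ Y, y ∉ S := fun y hy hyS => hYS ⟨y, hy, hyS⟩
      refine hf.2 Y (fun v hv => ⟨hY hv, hYS' v hv⟩) hYc fun u hu v hv => ?_
      simpa [hYS' u hu, hYS' v hv] using hmono u hu v hv

/-- If every layer of a breadth-first layering of `G[U]` has a clustered colouring with `m`
colours, then `U` has one with `2 * m` colours. -/
theorem exists_isClusteredOn_of_layers {V : Type*} {G : SimpleGraph V} {U : Set V} {m c : ℕ}
    (ρ : V → V) (d : V → ℕ)
    (hadj : ∀ u ∈ U, ∀ v ∈ U, G.Adj u v → ρ u = ρ v ∧ d u ≤ d v + 1)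
    (hlayer : ∀ r n, ∃ f, IsClusteredOn G {v ∈ U | ρ v = r ∧ d v = n} m c f) :
    ∃ f, IsClusteredOn G U (2 * m) c f := by
  choose f hf using hlayer
  have hlt : ∀ v ∈ U, f (ρ v) (d v) v < m := fun v hv => (hf _ _).1 v ⟨hv, rfl, rfl⟩
  refine ⟨fun v => f (ρ v) (d v) v + d v % 2 * m, fun v hv => ?_, fun W hW hWc hmono => ?_⟩
  · have := hlt v hv
    obtain h | h := Nat.mod_two_eq_zero_or_one (d v) <;> simp only [h] <;> omega
  · have hstep : ∀ u ∈ W, ∀ v ∈ W, G.Adj u v → (ρ u, d u) = (ρ v, d v) := by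
      intro u hu v hv huv
      have h1 := hadj u (hW hu) v (hW hv) huv
      have h2 := hadj v (hW hv) u (hW hu) huv.symm
      have h3 := hmono u hu v hv
      have h4 := hlt u (hW hu)
      have h5 := hlt v (hW hv)
      rw [Prod.mk.injEq]
      refine ⟨h1.1, ?_⟩
      obtain h6 | h6 := Nat.mod_two_eq_zero_or_one (d u) <;>
      obtain h7 | h7 := Nat.mod_two_eq_zero_or_one (d v) <;>
      simp only [h6, h7] at h3 <;> omega
    obtain ⟨⟨x, hx⟩⟩ := hWc.nonempty
    have hconst : ∀ v ∈ W, ρ v = ρ x ∧ d v = d x := fun v hv =>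
      Prod.mk.inj (hWc.eq_of_forall_adj (f := fun v => (ρ v, d v)) hstep hv hx)
    refine (hf (ρ x) (d x)).2 W (fun v hv => ⟨hW hv, hconst v hv⟩) hWc fun u hu v hv => ?_
    have := hmono u hu v hv
    simpa only [(hconst u hu).1, (hconst u hu).2, (hconst v hv).1, (hconst v hv).2,
      Nat.add_right_cancel_iff] using this

theorem exists_isClusteredOn {V : Type*} [Finite V] {G : SimpleGraph V} {k w : ℕ} (hk : 1 ≤ k)
    (hw : 1 ≤ w) (htw : HasTreewidthAtMost G w) (h : ℕ) (U : Set V)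
    (hmodel : ¬ HasModelIn (closureTree (h + 1) k) G U) :
    ∃ f, IsClusteredOn G U (2 ^ (h + 1) - 2) (k * w) f := by
  induction h generalizing U with
  | zero =>
    have hU : U = ∅ := by
      refine Set.eq_empty_of_forall_notMem fun v hv => hmodel ?_
      have hsub : ∀ a b : {l : List (Fin k) // l.length < 0 + 1}, a = b := by
        rintro ⟨a, ha⟩ ⟨b, hb⟩
        simp at ha hb
        simp [ha, hb]
      refine ⟨fun _ => {v}, by simpa using hv, fun _ => by simp, ?_, ?_⟩
      · exact fun a b hab => absurd (hsub a b) hab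
      · exact fun a b hab => absurd (hsub a b) hab.ne
    subst hU
    refine ⟨fun _ => 0, by simp, fun W hW _ _ => ?_⟩
    simp [Set.subset_empty_iff.1 hW]
  | succ h ih =>
    obtain ⟨ρ, d, hadj, hzero, hdown⟩ := G.exists_bfs_layering U
    have hpow : 2 ^ (h + 1 + 1) - 2 = 2 * (2 ^ (h + 1) - 2 + 1) := by
      have : 2 ≤ 2 ^ (h + 1) := by
        rw [pow_succ]
        have := Nat.one_le_two_pow (n := h)
        omega
      rw [pow_succ 2 (h + 1)]
      omega
    rw [hpow]
    refine exists_isClusteredOn_of_layers ρ d hadj fun r n => ?_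
    obtain rfl | ⟨n, rfl⟩ : n = 0 ∨ ∃ m, n = m + 1 := by cases n <;> simp
    · refine ⟨fun _ => 0, fun _ _ => Nat.succ_pos _, fun W hW _ _ => ?_⟩
      have hsub : W ⊆ {r} := fun v hv => (hzero v (hW hv).2.2).trans (hW hv).2.1
      calc W.ncard ≤ ({r} : Set V).ncard := Set.ncard_le_ncard hsub
        _ = 1 := Set.ncard_singleton r
        _ ≤ k * w := Nat.mul_pos hk hw
    · set W : Set V := {v ∈ U | ρ v = r ∧ d v = n + 1}
      obtain hemp | ⟨v₀, hv₀⟩ := W.eq_empty_or_nonempty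
      · refine ⟨fun _ => 0, by simp [hemp], fun Y hY _ _ => ?_⟩
        rw [hemp] at hY
        simp [Set.subset_empty_iff.1 hY]
      set A : Set V := {v ∈ U | ρ v = r ∧ d v ≤ n}
      have hreach : ∀ m v (hv : v ∈ A), d v = m →
          ∃ hr : r ∈ A, (G.induce A).Reachable ⟨r, hr⟩ ⟨v, hv⟩ := by
        intro m
        induction m with
        | zero =>
          intro v hv hd
          obtain rfl : v = r := (hzero v hd).trans hv.2.1
          exact ⟨hv, SimpleGraph.Reachable.refl _⟩
        | succ m ih' =>
          intro v hv hd
          obtain ⟨u, huU, hvu, hρ, hdu⟩ := hdown v hv.1 m hd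
          have hu : u ∈ A := ⟨huU, hρ.trans hv.2.1, by have := hv.2.2; omega⟩
          obtain ⟨hr, hru⟩ := ih' u hu hdu
          have huv : (G.induce A).Adj ⟨u, hu⟩ ⟨v, hv⟩ := hvu.symm
          exact ⟨hr, hru.trans huv.reachable⟩
      have hnb : ∀ v ∈ W, ∃ u ∈ A, G.Adj v u := by
        intro v hv
        obtain ⟨u, huU, hvu, hρ, hdu⟩ := hdown v hv.1 n hv.2.2
        exact ⟨u, ⟨huU, hρ.trans hv.2.1, hdu.le⟩, hvu⟩
      have hA : (G.induce A).Connected := by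
        obtain ⟨u, hu, -⟩ := hnb v₀ hv₀
        obtain ⟨hr, -⟩ := hreach _ u hu rfl
        rw [SimpleGraph.connected_iff_exists_forall_reachable]
        exact ⟨⟨r, hr⟩, fun v => (hreach _ v.1 v.2 rfl).2⟩
      have hdisj : Disjoint A W := Set.disjoint_left.2 fun v hv hv' => by
        have h1 := hv.2.2
        have h2 := hv'.2.2
        omega
      obtain ⟨S, hS, hSm⟩ := exists_small_hitting_set (Nat.succ_pos h) htw hA hdisj hnb
        fun hm => hmodel (hm.mono (Set.union_subset (fun v hv => hv.1) fun v hv => hv.1))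
      obtain ⟨f, hf⟩ := ih _ hSm
      exact hf.extend hS

/-- For all `h, k, w ≥ 1`, every `C(h,k)`-minor-free graph of treewidth
at most `w` is `(2^h - 2)`-colourable with clustering `k * w`. -/
theorem clustered_colouring_bounded_treewidth
    (h k w : ℕ) (hh : 1 ≤ h) (hk : 1 ≤ k) (hw : 1 ≤ w)
    (V : Type) [Finite V] (G : SimpleGraph V)
    (hminor : ¬ IsMinor (closureTree h k) G)
    (htw : HasTreewidthAtMost G w) :
    ClusteredColourable G (2 ^ h - 2) (k * w) := by
  obtain ⟨n, rfl⟩ : ∃ n, h = n + 1 := ⟨h - 1, by omega⟩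
  obtain ⟨f, hlt, hf⟩ := exists_isClusteredOn hk hw htw n Set.univ
    fun ⟨X, _, hX⟩ => hminor ⟨X, hX⟩
  refine ⟨fun v => ⟨f v, hlt v trivial⟩, fun v => ?_⟩
  set C := (G.induce {u | (⟨f u, hlt u trivial⟩ : Fin (2 ^ (n + 1) - 2)) =
    ⟨f v, hlt v trivial⟩}).connectedComponentMk ⟨v, rfl⟩
  rw [← Set.ncard_image_of_injective C.supp Subtype.val_injective]
  have hmem : ∀ u ∈ Subtype.val '' C.supp, f u = f v := by
    rintro _ ⟨⟨u, hu⟩, -, rfl⟩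
    exact congrArg Fin.val hu
  refine hf _ (Set.subset_univ _) ?_ fun u hu u' hu' => (hmem u hu).trans (hmem u' hu').symm
  refine C.connected_toSimpleGraph.map
    ⟨fun x => ⟨x.1.1, Set.mem_image_of_mem _ x.2⟩, fun h => h⟩ ?_
  rintro ⟨_, x, hx, rfl⟩
  exact ⟨⟨x, hx⟩, rfl⟩
end

section
/- For all integers h ≥ 2 and k ≥ 2, the graph W(h,k) contains C(h,k−1) as a minor. -/
/-- The branch set of a node `u` over `Fin n` in the complete `(n + 1)`-ary tree: the node `u`
itself together with all leaves whose longest prefix avoiding the letter `Fin.last n` is `u`. -/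
def branchSet (h n : ℕ) (u : List (Fin n)) : Set {l : List (Fin (n + 1)) // l.length < h} :=
  {v | v.1.takeWhile (· ≠ Fin.last n) = u.map Fin.castSucc ∧
    (v.1 = u.map Fin.castSucc ∨ v.1.length = h - 1)}

theorem takeWhile_ne_last_map_castSucc_append {n : ℕ} (u : List (Fin n)) (m : ℕ) :
    (u.map Fin.castSucc ++ List.replicate m (Fin.last n)).takeWhile (· ≠ Fin.last n) =
      u.map Fin.castSucc := by
  rw [List.takeWhile_append_of_pos (by simp [Fin.castSucc_ne_last])]
  cases m <;> simp [List.replicate_succ]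

theorem map_castSucc_mem_branchSet {h n : ℕ} (u : List (Fin n)) (hu : u.length < h) :
    (⟨u.map Fin.castSucc, by simpa using hu⟩ : {l : List (Fin (n + 1)) // l.length < h}) ∈
      branchSet h n u :=
  ⟨by simp, Or.inl rfl⟩

theorem weakClosureTree_adj_of_prefix {h k : ℕ} {u v : {l : List (Fin k) // l.length < h}}
    (hne : u ≠ v) (hv : v.1.length = h - 1) (huv : u.1 <+: v.1) :
    (weakClosureTree h k).Adj u v :=
  (SimpleGraph.fromRel_adj _ _ _).2 ⟨hne, Or.inl ⟨hv, huv⟩⟩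

theorem connected_induce_branchSet {h n : ℕ} (u : List (Fin n)) (hu : u.length < h) :
    ((weakClosureTree h (n + 1)).induce (branchSet h n u)).Connected := by
  rw [SimpleGraph.connected_iff_exists_forall_reachable]
  refine ⟨⟨_, map_castSucc_mem_branchSet u hu⟩, ?_⟩
  rintro ⟨v, hv, hv'⟩
  by_cases hvu : v.1 = u.map Fin.castSucc
  · obtain ⟨v, hlt⟩ := v
    obtain rfl : v = u.map Fin.castSucc := hvu
    exact SimpleGraph.Reachable.refl _
  · refine SimpleGraph.Adj.reachable (weakClosureTree_adj_of_prefix ?_ (hv'.resolve_left hvu) ?_)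
    · rintro rfl
      exact hvu rfl
    · change u.map Fin.castSucc <+: v.1
      rw [← hv]
      exact List.takeWhile_prefix _

theorem disjoint_branchSet {h n : ℕ} {u w : List (Fin n)} (huw : u ≠ w) :
    Disjoint (branchSet h n u) (branchSet h n w) := by
  rw [Set.disjoint_left]
  rintro v ⟨hu, -⟩ ⟨hw, -⟩
  exact huw (List.map_injective_iff.2 (Fin.castSucc_injective n) (hu.symm.trans hw))

theorem exists_adj_branchSet_of_prefix {h n : ℕ} {u w : List (Fin n)} (hw : w.length < h)
    (huw : u <+: w) (hne : u ≠ w) :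
    ∃ x ∈ branchSet h n u, ∃ y ∈ branchSet h n w, (weakClosureTree h (n + 1)).Adj x y := by
  have hlen : (w.map Fin.castSucc ++
      List.replicate (h - 1 - w.length) (Fin.last n)).length = h - 1 := by
    simp only [List.length_append, List.length_map, List.length_replicate]
    omega
  have hx := map_castSucc_mem_branchSet u (huw.length_le.trans_lt hw)
  have hy : (⟨_, by rw [hlen]; omega⟩ : {l : List (Fin (n + 1)) // l.length < h}) ∈
      branchSet h n w :=
    ⟨takeWhile_ne_last_map_castSucc_append w (h - 1 - w.length), Or.inr hlen⟩
  exact ⟨_, hx, _, hy, weakClosureTree_adj_of_prefix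
    (fun e => Set.disjoint_left.1 (disjoint_branchSet hne) hx (e ▸ hy)) hlen
    ((huw.map _).trans (List.prefix_append _ _))⟩

/-- For all `h ≥ 2` and `k ≥ 2`, the weak closure `W(h,k)` contains
`C(h,k-1)` as a minor. -/
theorem closureTree_isMinor_weakClosureTree (h k : ℕ) (hh : 2 ≤ h) (hk : 2 ≤ k) :
    IsMinor (closureTree h (k - 1)) (weakClosureTree h k) := by
  obtain ⟨n, rfl⟩ : ∃ n, k = n + 1 := ⟨k - 1, by omega⟩
  refine ⟨fun u => branchSet h n u.1, fun u => connected_induce_branchSet u.1 u.2,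
    fun u w huw => disjoint_branchSet fun e => huw (Subtype.ext e), fun u w huw => ?_⟩
  obtain ⟨hne, hpre | hpre⟩ := (SimpleGraph.fromRel_adj _ _ _).1 huw
  · exact exists_adj_branchSet_of_prefix w.2 hpre fun e => hne (Subtype.ext e)
  · obtain ⟨x, hx, y, hy, hxy⟩ :=
      exists_adj_branchSet_of_prefix u.2 hpre fun e => hne (Subtype.ext e.symm)
    exact ⟨y, hy, x, hx, hxy.symm⟩
end

section
/- For all integers h ≥ 2 and k ≥ 1, if a graph G contains W(h,6k) as a minor, then G contains subgraphs G′ and G″, both containing W(h,k) as a minor, such that |V(G′) ∩ V(G″)| ≤ 1. -/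
open SimpleGraph

/-! ### Splitting a connected set at a vertex -/

section Connected

variable {V : Type*} {G : SimpleGraph V}

lemma induce_singleton_connected (v : V) : (G.induce {v}).Connected :=
  { preconnected := fun a b => by rw [Subsingleton.elim a b]
    nonempty := ⟨⟨v, rfl⟩⟩ }

/-- A connected set has an edge leaving each of its nonempty proper subsets. -/
lemma exists_adj_of_ssubset_of_connected {A D : Set V} (hA : (G.induce A).Connected)
    (hD : D.Nonempty) (hDA : D ⊂ A) : ∃ x ∈ D, ∃ y ∈ A \ D, G.Adj x y := by
  obtain ⟨u, hu⟩ := hD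
  obtain ⟨w, hwA, hwD⟩ := Set.exists_of_ssubset hDA
  obtain ⟨p⟩ := hA.preconnected ⟨u, hDA.1 hu⟩ ⟨w, hwA⟩
  obtain ⟨d, -, h₁, h₂⟩ := p.exists_boundary_dart (Subtype.val ⁻¹' D) hu hwD
  exact ⟨d.fst, h₁, d.snd, ⟨d.snd.2, h₂⟩, d.adj⟩

/-- The connected component of `w` in the subgraph induced on a finite set `S`. -/
lemma exists_connected_closed [Finite V] {S : Set V} {w : V} (hw : w ∈ S) :
    ∃ C ⊆ S, w ∈ C ∧ (G.induce C).Connected ∧ ∀ x ∈ C, ∀ y ∈ S, G.Adj x y → y ∈ C := by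
  obtain ⟨C, hC⟩ :=
    (Set.toFinite {C : Set V | C ⊆ S ∧ w ∈ C ∧ (G.induce C).Connected}).exists_maximal
      ⟨{w}, by simpa using hw, rfl, induce_singleton_connected w⟩
  obtain ⟨hCS, hwC, hconn⟩ := hC.prop
  refine ⟨C, hCS, hwC, hconn, fun x hx y hy hxy => ?_⟩
  have hle : C ∪ {y} ⊆ C := hC.le_of_ge
    ⟨Set.union_subset hCS (by simpa using hy), Or.inl hwC,
      connected_induce_union hconn.preconnected (induce_singleton_connected y).preconnected
        hx rfl hxy⟩ Set.subset_union_left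
  exact hle (Or.inr rfl)

/-- Removing a union of components of `A \ {v}` from a connected set `A` keeps it connected. -/
lemma connected_diff_of_closed [Finite V] {A C : Set V} {v : V} (hA : (G.induce A).Connected)
    (hv : v ∈ A) (hC : C ⊆ A \ {v}) (hclosed : ∀ x ∈ C, ∀ y ∈ A \ {v}, G.Adj x y → y ∈ C) :
    (G.induce (A \ C)).Connected := by
  obtain ⟨D, hDS, hvD, hconn, hDc⟩ := exists_connected_closed (G := G) (S := A \ C) (w := v)
    ⟨hv, fun h => (hC h).2 rfl⟩
  suffices h : D = A \ C by rwa [← h]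
  by_contra hne
  have hlt : C ∪ D ⊂ A := by
    refine (Set.union_subset (hC.trans Set.sdiff_subset)
      (hDS.trans Set.sdiff_subset)).ssubset_of_ne fun h => hne ?_
    refine hDS.antisymm fun x hx => ?_
    rcases h ▸ hx.1 with h' | h'
    exacts [absurd h' hx.2, h']
  obtain ⟨x, hx, y, ⟨hyA, hy⟩, hxy⟩ :=
    exists_adj_of_ssubset_of_connected hA ⟨v, Or.inr hvD⟩ hlt
  rw [Set.mem_union, not_or] at hy
  rcases hx with hx | hx
  · exact hy.1 (hclosed x hx y ⟨hyA, fun h => hy.2 (h ▸ hvD)⟩ hxy)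
  · exact hy.2 (hDc x hx y ⟨hyA, hy.1⟩ hxy)

/-- A connected set `X` with property `Q` splits into connected sets `A` and `B` sharing at most
one vertex, where `A` is almost minimal subject to `Q`. -/
lemma exists_connected_split [Finite V] {X : Set V} (hX : (G.induce X).Connected)
    (Q : Set V → Prop) (hQ : Q X) :
    ∃ A B : Set V, ∃ v : V, A ∪ B = X ∧ A ∩ B ⊆ {v} ∧ (G.induce A).Connected ∧
      (G.induce B).Connected ∧ Q A ∧ (B = X ∨ ∃ A₁ A₂, A = A₁ ∪ A₂ ∧ ¬ Q A₁ ∧ ¬ Q A₂) := by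
  let Adm : Set V → V → Prop := fun A v => A ⊆ X ∧ v ∈ A ∧ (G.induce A).Connected ∧
    (G.induce (X \ A ∪ {v})).Connected ∧ Q A
  obtain ⟨⟨x₀, hx₀⟩⟩ := hX.nonempty
  obtain ⟨A, hmin⟩ := (Set.toFinite {A : Set V | ∃ v, Adm A v}).exists_minimal
    ⟨X, x₀, subset_rfl, hx₀, hX, by
      rw [Set.sdiff_self, Set.empty_union]
      exact induce_singleton_connected x₀, hQ⟩
  obtain ⟨v, hAX, hvA, hA, hB, hQA⟩ := hmin.prop
  have hsmall : ∀ A' u, A' ⊂ A → u ∈ A' → (G.induce A').Connected →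
      (G.induce (X \ A' ∪ {u})).Connected → ¬ Q A' := fun A' u hlt hu h₁ h₂ h₃ =>
    hlt.2 (hmin.le_of_le ⟨u, hlt.1.trans hAX, hu, h₁, h₂, h₃⟩ hlt.1)
  refine ⟨A, X \ A ∪ {v}, v, ?_, ?_, hA, hB, hQA, ?_⟩
  · ext x; have := @hAX x; by_cases hx : x = v <;> simp_all
  · rintro x ⟨h₁, h₂ | h₂⟩
    exacts [absurd h₁ h₂.2, h₂]
  by_cases hAv : A = {v}
  · left
    rw [hAv, Set.sdiff_union_self, Set.union_eq_left, ← hAv]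
    exact hAX
  right
  have hvlt : {v} ⊂ A := (Set.singleton_subset_iff.2 hvA).ssubset_of_ne (Ne.symm hAv)
  obtain ⟨x, hx, w, hw, hvw⟩ :=
    exists_adj_of_ssubset_of_connected hA (Set.singleton_nonempty v) hvlt
  obtain rfl : x = v := hx
  obtain ⟨C, hCA, hwC, hC, hclosed⟩ := exists_connected_closed (G := G) hw
  have hxC : x ∉ C := fun h => (hCA h).2 rfl
  have hCx : (G.induce (C ∪ {x})).Connected := connected_induce_union hC.preconnected
    (induce_singleton_connected x).preconnected hwC rfl hvw.symm
  have hCltA : C ⊂ A := ⟨hCA.trans Set.sdiff_subset, fun h => hxC (h hvA)⟩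
  by_cases hCeq : C = A \ {x}
  · refine ⟨{x}, C, ?_, hsmall _ x hvlt rfl (induce_singleton_connected x) ?_,
      hsmall C w hCltA hwC hC ?_⟩
    · rw [hCeq, Set.union_sdiff_self, Set.union_eq_right.2 hvlt.1]
    · rwa [Set.sdiff_union_self, Set.union_eq_left.2 (hvlt.1.trans hAX)]
    · have : X \ C = X \ A ∪ {x} := by
        ext y; have := @hAX y; rw [hCeq]; by_cases hy : y = x <;> simp_all
      rw [this]
      exact connected_induce_union hB.preconnected (induce_singleton_connected w).preconnected
        (Or.inr rfl) rfl hvw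
  · have hAC := connected_diff_of_closed hA hvA hCA hclosed
    refine ⟨C ∪ {x}, A \ C, ?_, hsmall _ x ?_ (Or.inr rfl) hCx ?_,
      hsmall _ x ?_ ⟨hvA, hxC⟩ hAC ?_⟩
    · ext y; have := @hCA y; by_cases hy : y = x <;> simp_all; tauto
    · refine (Set.union_subset hCltA.1 hvlt.1).ssubset_of_ne fun h => hCeq ?_
      rw [← h, Set.union_sdiff_right, Set.sdiff_singleton_eq_self hxC]
    · have : X \ (C ∪ {x}) ∪ {x} = (X \ A ∪ {x}) ∪ (A \ C) := by
        ext y; have := @hCA y; have := @hAX y; by_cases hy : y = x <;> simp_all; tauto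
      rw [this]
      exact induce_union_connected hB.preconnected hAC.preconnected
        ⟨x, Or.inr rfl, hvA, hxC⟩
    · exact ⟨Set.sdiff_subset, fun h => (h (hCltA.1 hwC)).2 hwC⟩
    · have : X \ (A \ C) ∪ {x} = (X \ A ∪ {x}) ∪ (C ∪ {x}) := by
        ext y; have := @hCA y; have := @hAX y; by_cases hy : y = x <;> simp_all; tauto
      rw [this]
      exact induce_union_connected hB.preconnected hCx.preconnected ⟨x, Or.inr rfl, Or.inr rfl⟩

end Connected

/-! ### Embeddings of complete trees -/

section Trees

variable {k K : ℕ}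

/-- An embedding of the infinite `k`-ary tree into the infinite `K`-ary tree that preserves depth
and ancestry. -/
structure IsTreeEmbedding (φ : List (Fin k) → List (Fin K)) : Prop where
  length_eq : ∀ l, (φ l).length = l.length
  injective : Function.Injective φ
  prefix_of_prefix : ∀ l l', l <+: l' → φ l <+: φ l'

/-- The complete `K`-ary tree with leaves at distance `n` from the root contains a complete
`k`-ary tree all of whose leaves satisfy `P`. -/
def HasSubtree (k : ℕ) {K : ℕ} (n : ℕ) (P : List (Fin K) → Prop) : Prop :=
  ∃ φ : List (Fin k) → List (Fin K), IsTreeEmbedding φ ∧ ∀ l, l.length = n → P (φ l)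

lemma isTreeEmbedding_map (f : Fin k ↪ Fin K) : IsTreeEmbedding (List.map f) where
  length_eq _ := List.length_map _
  injective := List.map_injective_iff.2 f.injective
  prefix_of_prefix _ _ h := h.map f

/-- Combine embeddings of the subtrees below the children of the root. -/
def joinTrees (f : Fin k → Fin K) (φ : Fin k → List (Fin k) → List (Fin K)) :
    List (Fin k) → List (Fin K)
  | [] => []
  | j :: l => f j :: φ j l

lemma isTreeEmbedding_joinTrees {f : Fin k → Fin K} (hf : Function.Injective f)
    {φ : Fin k → List (Fin k) → List (Fin K)} (hφ : ∀ j, IsTreeEmbedding (φ j)) :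
    IsTreeEmbedding (joinTrees f φ) where
  length_eq l := by cases l <;> simp [joinTrees, (hφ _).length_eq]
  injective := by
    rintro (_ | ⟨i, l⟩) (_ | ⟨j, l'⟩) h <;>
      simp only [joinTrees, List.cons.injEq, reduceCtorEq] at h ⊢
    obtain rfl := hf h.1
    exact ⟨rfl, (hφ i).injective h.2⟩
  prefix_of_prefix := by
    rintro (_ | ⟨i, l⟩) (_ | ⟨j, l'⟩) h <;>
      simp only [joinTrees, List.nil_prefix, List.prefix_nil, List.cons_prefix_cons,
        reduceCtorEq] at h ⊢
    obtain ⟨rfl, h⟩ := h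
    exact ⟨rfl, (hφ i).prefix_of_prefix _ _ h⟩

lemma exists_isTreeEmbedding_of_le_card {n : ℕ} {P : List (Fin K) → Prop} (s : Finset (Fin K))
    (hs : k ≤ s.card) (h : ∀ i ∈ s, HasSubtree k n fun l => P (i :: l)) :
    ∃ φ : List (Fin k) → List (Fin K), IsTreeEmbedding φ ∧ (∀ l, l.length = n + 1 → P (φ l)) ∧
      ∀ l, ∀ i ∈ (φ l).head?, i ∈ s := by
  obtain ⟨f⟩ : Nonempty (Fin k ↪ s) :=
    Function.Embedding.nonempty_of_card_le (by simpa using hs)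
  choose φ hφ hP using fun j => h (f j) (f j).2
  refine ⟨joinTrees (fun j => f j) φ,
    isTreeEmbedding_joinTrees (Subtype.val_injective.comp f.injective) hφ, ?_, ?_⟩
  · rintro (_ | ⟨j, l⟩) hl
    · simp at hl
    · exact hP j l (by simpa using hl)
  · rintro (_ | ⟨j, l⟩) i hi <;> simp [joinTrees] at hi
    exact hi ▸ (f j).2

lemma hasSubtree_of_forall (hk : k ≤ K) {n : ℕ} {P : List (Fin K) → Prop}
    (h : ∀ l, l.length = n → P l) : HasSubtree k n P :=
  ⟨_, isTreeEmbedding_map (Fin.castLEEmb hk), fun l hl => h _ (by simpa using hl)⟩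

/-- Ramsey property of complete trees: if the leaves are coloured with finitely many colours, then
there is a monochromatic subtree of proportional arity. -/
lemma exists_hasSubtree_of_forall_exists {ι : Type*} [Fintype ι] [Nonempty ι]
    (hk : Fintype.card ι * k ≤ K) (n : ℕ) (P : ι → List (Fin K) → Prop)
    (h : ∀ l, l.length = n → ∃ c, P c l) : ∃ c, HasSubtree k n (P c) := by
  classical
  induction n generalizing P with
  | zero =>
    obtain ⟨c, hc⟩ := h [] rfl
    refine ⟨c, hasSubtree_of_forall ((Nat.le_mul_of_pos_left _ Fintype.card_pos).trans hk) ?_⟩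
    intro l hl
    rwa [List.length_eq_zero_iff.1 hl]
  | succ n ih =>
    choose f hf using fun i : Fin K => ih (fun c l => P c (i :: l)) fun l hl => h _ (by simp [hl])
    obtain ⟨c, hc⟩ := Fintype.exists_le_card_fiber_of_mul_le_card (n := k) f (by simpa using hk)
    obtain ⟨φ, hφ, hP, -⟩ := exists_isTreeEmbedding_of_le_card (n := n) (P := P c) _ hc
      fun i hi => by simpa [(Finset.mem_filter.1 hi).2] using hf i
    exact ⟨c, φ, hφ, hP⟩

end Trees

/-! ### Minors -/

/-- A model of `H` whose branch sets lie in `S` is a model in the subgraph induced on `S`. -/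
lemma isMinor_coe_induce {α V : Type*} {H : SimpleGraph α} {G : SimpleGraph V} {S : Set V}
    (Y : α → Set V) (hS : ∀ a, Y a ⊆ S) (hconn : ∀ a, (G.induce (Y a)).Connected)
    (hdisj : Pairwise fun a b => Disjoint (Y a) (Y b))
    (hadj : ∀ a b, H.Adj a b → ∃ x ∈ Y a, ∃ y ∈ Y b, G.Adj x y) :
    IsMinor H ((⊤ : G.Subgraph).induce S).coe := by
  refine ⟨fun a => Subtype.val ⁻¹' Y a, fun a => ?_, fun a b hab => (hdisj hab).preimage _, ?_⟩
  · let e : G.induce (Y a) ≃g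
        ((⊤ : G.Subgraph).induce S).coe.induce (Subtype.val ⁻¹' Y a) :=
      { toFun := fun x => ⟨⟨x, hS a x.2⟩, x.2⟩
        invFun := fun x => ⟨x.1.1, x.2⟩
        left_inv := fun _ => rfl
        right_inv := fun _ => rfl
        map_rel_iff' := by
          rintro ⟨x, hx⟩ ⟨y, hy⟩
          simp [hS a hx, hS a hy] }
    exact e.connected_iff.1 (hconn a)
  · intro a b hab
    obtain ⟨x, hx, y, hy, hxy⟩ := hadj a b hab
    exact ⟨⟨x, hS a hx⟩, hx, ⟨y, hS b hy⟩, hy, by simp [hS a hx, hS b hy, hxy]⟩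

section Model

variable {h k K : ℕ} {V : Type*} {G : SimpleGraph V}

/-- The vertices of the model of `W(h,k)` obtained from a model `X` of `W(h,K)` by restricting to
the image of `φ` and replacing the branch set of the root by `A`. -/
def restrictedVerts (h : ℕ) (X : List (Fin K) → Set V) (A : Set V)
    (φ : List (Fin k) → List (Fin K)) : Set V :=
  A ∪ ⋃ l ∈ {l : List (Fin k) | l ≠ [] ∧ l.length < h}, X (φ l)

lemma isMinor_restrictedVerts (hh : 2 ≤ h) {X : List (Fin K) → Set V} {A : Set V}
    {φ : List (Fin k) → List (Fin K)} (hφ : IsTreeEmbedding φ)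
    (hconn : ∀ l, l.length < h → (G.induce (X l)).Connected)
    (hdisj : ∀ l l', l.length < h → l'.length < h → l ≠ l' → Disjoint (X l) (X l'))
    (hadj : ∀ l l', l'.length = h - 1 → l <+: l' → l ≠ l' → ∃ x ∈ X l, ∃ y ∈ X l', G.Adj x y)
    (hA : (G.induce A).Connected) (hAX : A ⊆ X [])
    (hleaf : ∀ l, l.length = h - 1 → ∃ x ∈ A, ∃ y ∈ X (φ l), G.Adj x y) :
    IsMinor (weakClosureTree h k) ((⊤ : G.Subgraph).induce (restrictedVerts h X A φ)).coe := by
  classical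
  have hnil : ∀ l, φ l = [] ↔ l = [] := fun l => by
    rw [← List.length_eq_zero_iff, hφ.length_eq, List.length_eq_zero_iff]
  let Y : {l : List (Fin k) // l.length < h} → Set V := fun a => if a.1 = [] then A else X (φ a.1)
  have hYX : ∀ a, Y a ⊆ X (φ a.1) := by
    intro a
    by_cases ha : a.1 = []
    · simpa [Y, ha, (hnil []).2 rfl] using hAX
    · simp [Y, ha]
  have hlt : ∀ a : {l : List (Fin k) // l.length < h}, (φ a.1).length < h :=
    fun a => (hφ.length_eq _).trans_lt a.2
  have key : ∀ a b : {l : List (Fin k) // l.length < h}, a ≠ b → b.1.length = h - 1 →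
      a.1 <+: b.1 → ∃ x ∈ Y a, ∃ y ∈ Y b, G.Adj x y := by
    intro a b hab hb hpre
    have hb0 : b.1 ≠ [] := by
      intro h0
      simp only [h0, List.length_nil] at hb
      omega
    by_cases ha : a.1 = []
    · simpa [Y, ha, hb0] using hleaf b.1 hb
    · simpa [Y, ha, hb0] using hadj (φ a.1) (φ b.1) (by rw [hφ.length_eq, hb])
        (hφ.prefix_of_prefix _ _ hpre) fun he => hab (Subtype.ext (hφ.injective he))
  refine isMinor_coe_induce Y ?_ ?_ ?_ ?_
  · intro a x hx
    by_cases ha : a.1 = []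
    · exact Or.inl (by simpa [Y, ha] using hx)
    · exact Or.inr (Set.mem_biUnion (show a.1 ∈ {l | l ≠ [] ∧ l.length < h} from ⟨ha, a.2⟩)
        (hYX a hx))
  · intro a
    by_cases ha : a.1 = []
    · rwa [show Y a = A from if_pos ha]
    · rw [show Y a = X (φ a.1) from if_neg ha]
      exact hconn _ (hlt a)
  · intro a b hab
    exact (hdisj _ _ (hlt a) (hlt b)
      fun he => hab (Subtype.ext (hφ.injective he))).mono (hYX a) (hYX b)
  · intro a b hab
    rw [weakClosureTree, fromRel_adj] at hab
    obtain ⟨hne, hab | hab⟩ := hab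
    · exact key a b hne hab.1 hab.2
    · obtain ⟨x, hx, y, hy, hxy⟩ := key b a hne.symm hab.1 hab.2
      exact ⟨y, hy, x, hx, hxy.symm⟩

lemma restrictedVerts_inter_subset {X : List (Fin K) → Set V} {A B : Set V}
    {φ ψ : List (Fin k) → List (Fin K)} (hφ : IsTreeEmbedding φ) (hψ : IsTreeEmbedding ψ)
    (hdisj : ∀ l l', l.length < h → l'.length < h → l ≠ l' → Disjoint (X l) (X l'))
    (hA : A ⊆ X []) (hB : B ⊆ X []) {s t : Finset (Fin K)} (hst : Disjoint s t)
    (hs : ∀ l, ∀ i ∈ (φ l).head?, i ∈ s) (ht : ∀ l, ∀ i ∈ (ψ l).head?, i ∈ t) :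
    restrictedVerts h X A φ ∩ restrictedVerts h X B ψ ⊆ A ∩ B := by
  have hφ0 : ∀ l, l ≠ [] → φ l ≠ [] := fun l hl he =>
    hl (List.length_eq_zero_iff.1 (by rw [← hφ.length_eq, he, List.length_nil]))
  have hψ0 : ∀ l, l ≠ [] → ψ l ≠ [] := fun l hl he =>
    hl (List.length_eq_zero_iff.1 (by rw [← hψ.length_eq, he, List.length_nil]))
  rintro x ⟨h₁, h₂⟩
  simp only [restrictedVerts, Set.mem_union, Set.mem_iUnion, Set.mem_ofPred_eq,
    exists_prop] at h₁ h₂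
  rcases h₁ with h₁ | ⟨l, ⟨hl, hlh⟩, h₁⟩ <;> rcases h₂ with h₂ | ⟨l', ⟨hl', hlh'⟩, h₂⟩
  · exact ⟨h₁, h₂⟩
  · exact absurd h₂ (Set.disjoint_left.1 (hdisj [] (ψ l') (Nat.zero_lt_of_lt hlh')
      (by rwa [hψ.length_eq]) (hψ0 _ hl').symm) (hA h₁))
  · exact absurd h₁ (Set.disjoint_left.1 (hdisj [] (φ l) (Nat.zero_lt_of_lt hlh)
      (by rwa [hφ.length_eq]) (hφ0 _ hl).symm) (hB h₂))
  · refine absurd h₂ (Set.disjoint_left.1 (hdisj (φ l) (ψ l') (by rwa [hφ.length_eq])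
      (by rwa [hψ.length_eq]) fun he => ?_) h₁)
    obtain ⟨i, hi⟩ : ∃ i, (φ l).head? = some i :=
      Option.isSome_iff_exists.1 (by simpa using hφ0 _ hl)
    exact Finset.disjoint_left.1 hst (hs l i hi) (ht l' i (he ▸ hi))

end Model

/-- Given sets `T l` attached to the leaves `l` of the complete `6k`-ary tree, a connected set `X`
meeting every `T l` splits into two connected sets sharing at most one vertex, each of which serves
the leaves below `k` children of the root in a `k`-ary subtree. -/
lemma exists_split_of_leaves {V : Type*} [Finite V] {G : SimpleGraph V} {k n : ℕ}
    {X : Set V} (hX : (G.induce X).Connected) (T : List (Fin (6 * k)) → Set V)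
    (hT : ∀ l, l.length = n + 1 → (X ∩ T l).Nonempty) :
    ∃ (A B : Set V) (v : V) (s t : Finset (Fin (6 * k))), A ⊆ X ∧ B ⊆ X ∧ A ∩ B ⊆ {v} ∧
      (G.induce A).Connected ∧ (G.induce B).Connected ∧ Disjoint s t ∧ k ≤ s.card ∧ k ≤ t.card ∧
      (∀ i ∈ s, HasSubtree k n fun l => (A ∩ T (i :: l)).Nonempty) ∧
      (∀ i ∈ t, HasSubtree k n fun l => (B ∩ T (i :: l)).Nonempty) := by
  classical
  let good : Set V → Finset (Fin (6 * k)) := fun A =>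
    Finset.univ.filter fun i => HasSubtree k n fun l => (A ∩ T (i :: l)).Nonempty
  have hgood : ∀ A i, i ∈ good A ↔ HasSubtree k n fun l => (A ∩ T (i :: l)).Nonempty := by
    simp [good]
  have hgX : (good X).card = 6 * k := by
    have : good X = Finset.univ := Finset.eq_univ_of_forall fun i => (hgood _ _).2 <|
      hasSubtree_of_forall (by omega) fun l hl => hT _ (by simp [hl])
    simp [this]
  obtain ⟨A, B, v, hAB, hv, hA, hB, hQ, hcase⟩ :=
    exists_connected_split hX (fun A => k ≤ (good A).card) (by omega)
  have hBcard : 2 * k ≤ (good B).card := by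
    rcases hcase with rfl | ⟨A₁, A₂, rfl, h₁, h₂⟩
    · omega
    · have hcover : Finset.univ ⊆ good A₁ ∪ good A₂ ∪ good B := by
        intro i _
        obtain ⟨c, hc⟩ := exists_hasSubtree_of_forall_exists (k := k) (K := 6 * k) (ι := Fin 3)
          (by simp; omega) n (fun c l => (![A₁, A₂, B] c ∩ T (i :: l)).Nonempty) fun l hl => by
            obtain ⟨x, hx, hxT⟩ := hT (i :: l) (by simp [hl])
            rw [← hAB] at hx
            rcases hx with (hx | hx) | hx
            exacts [⟨0, x, hx, hxT⟩, ⟨1, x, hx, hxT⟩, ⟨2, x, hx, hxT⟩]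
        simp only [Finset.mem_union, hgood]
        fin_cases c
        exacts [Or.inl (Or.inl hc), Or.inl (Or.inr hc), Or.inr hc]
      have hle := Finset.card_le_card hcover
      have hu₁ := Finset.card_union_le (good A₁ ∪ good A₂) (good B)
      have hu₂ := Finset.card_union_le (good A₁) (good A₂)
      rw [Finset.card_univ, Fintype.card_fin] at hle
      omega
  obtain ⟨s, hs, hsk⟩ := Finset.exists_subset_card_eq hQ
  have hsdiff := Finset.le_card_sdiff s (good B)
  exact ⟨A, B, v, s, good B \ s, hAB ▸ Set.subset_union_left, hAB ▸ Set.subset_union_right, hv, hA,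
    hB, Finset.disjoint_sdiff, hsk.ge, by omega, fun i hi => (hgood _ _).1 (hs hi),
    fun i hi => (hgood _ _).1 (Finset.mem_sdiff.1 hi).1⟩

/-- For `h ≥ 2` and `k ≥ 1`, if a graph `G` contains `W(h,6k)` as a
minor, then `G` contains subgraphs `G'` and `G''`, both containing `W(h,k)` as a minor,
such that `|V(G') ∩ V(G'')| ≤ 1`. -/
theorem weakClosureTree_minor_split (h k : ℕ) (hh : 2 ≤ h) (hk : 1 ≤ k)
    (V : Type) [Finite V] (G : SimpleGraph V)
    (hm : IsMinor (weakClosureTree h (6 * k)) G) :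
    ∃ G₁ G₂ : G.Subgraph,
      IsMinor (weakClosureTree h k) G₁.coe ∧
      IsMinor (weakClosureTree h k) G₂.coe ∧
      (G₁.verts ∩ G₂.verts).ncard ≤ 1 := by
  classical
  obtain ⟨X₀, hconn₀, hdisj₀, hadj₀⟩ := hm
  let X : List (Fin (6 * k)) → Set V := fun l => if hl : l.length < h then X₀ ⟨l, hl⟩ else ∅
  have hX : ∀ l (hl : l.length < h), X l = X₀ ⟨l, hl⟩ := fun l hl => dif_pos hl
  have hconn : ∀ l, l.length < h → (G.induce (X l)).Connected := fun l hl => by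
    rw [hX l hl]
    exact hconn₀ _
  have hdisj : ∀ l l', l.length < h → l'.length < h → l ≠ l' → Disjoint (X l) (X l') := by
    intro l l' hl hl' hne
    rw [hX l hl, hX l' hl']
    exact hdisj₀ fun he => hne (congrArg Subtype.val he)
  have hadj : ∀ l l', l'.length = h - 1 → l <+: l' → l ≠ l' →
      ∃ x ∈ X l, ∃ y ∈ X l', G.Adj x y := by
    intro l l' hl' hpre hne
    have hlt' : l'.length < h := by omega
    have hlt : l.length < h := hpre.length_le.trans_lt hlt'
    rw [hX l hlt, hX l' hlt']
    refine hadj₀ _ _ ?_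
    rw [weakClosureTree, fromRel_adj]
    exact ⟨fun he => hne (congrArg Subtype.val he), Or.inl ⟨hl', hpre⟩⟩
  obtain ⟨n, rfl⟩ : ∃ n, h = n + 2 := ⟨h - 2, by omega⟩
  obtain ⟨A, B, v, s, t, hAX, hBX, hv, hA, hB, hst, hs, ht, hsA, htB⟩ :=
    exists_split_of_leaves (n := n) (hconn [] (by simp))
      (fun l => {x | ∃ y ∈ X l, G.Adj x y}) fun l hl => by
        obtain ⟨x, hx, hxy⟩ := hadj [] l hl (List.nil_prefix) (by rintro rfl; simp at hl)
        exact ⟨x, hx, hxy⟩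
  obtain ⟨φ, hφ, hφA, hφs⟩ := exists_isTreeEmbedding_of_le_card s hs
    (P := fun l => (A ∩ {x | ∃ y ∈ X l, G.Adj x y}).Nonempty) hsA
  obtain ⟨ψ, hψ, hψB, hψt⟩ := exists_isTreeEmbedding_of_le_card t ht
    (P := fun l => (B ∩ {x | ∃ y ∈ X l, G.Adj x y}).Nonempty) htB
  refine ⟨(⊤ : G.Subgraph).induce (restrictedVerts (n + 2) X A φ),
    (⊤ : G.Subgraph).induce (restrictedVerts (n + 2) X B ψ),
    isMinor_restrictedVerts hh hφ hconn hdisj hadj hA hAX hφA,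
    isMinor_restrictedVerts hh hψ hconn hdisj hadj hB hBX hψB, ?_⟩
  exact (Set.ncard_le_ncard ((restrictedVerts_inter_subset hφ hψ hdisj hAX hBX hst hφs hψt).trans
    hv)).trans_eq (Set.ncard_singleton v)
end

section
/- Let f(h) := (4^h − 4)/6 for every integer h ≥ 1. Then there is a function g : ℕ × ℕ → ℕ such that for all integers h ≥ 1 and k ≥ 1, every graph either contains W(h,k) as a minor or is f(h)-colourable with clustering g(h,k). -/
namespace WeakClosure

variable {V : Type}

/-- Some edge of `G` joins `A` and `B`. -/
def Touch (G : SimpleGraph V) (A B : Set V) : Prop :=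
  ∃ a ∈ A, ∃ b ∈ B, G.Adj a b

/-- `S` is nonempty and connected in `G`, expressed through cuts. -/
def Conn (G : SimpleGraph V) (S : Set V) : Prop :=
  S.Nonempty ∧ ∀ U ⊆ S, U.Nonempty → (S \ U).Nonempty → Touch G U (S \ U)

/-- A model of the weak closure of the complete `k`-ary tree with `n + 1` levels inside the
vertex set `S`, all of whose leaf branch sets satisfy `Φ`. -/
def Model (G : SimpleGraph V) (k : ℕ) : ℕ → (Set V → Prop) → Set V → Prop
  | 0, Φ, S => ∃ B ⊆ S, Conn G B ∧ Φ B
  | n + 1, Φ, S => ∃ A ⊆ S, Conn G A ∧ ∃ T : Fin k → Set V,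
      (Pairwise fun i j => Disjoint (T i) (T j)) ∧
      ∀ i, T i ⊆ S \ A ∧ Model G k n (fun B => Φ B ∧ Touch G A B) (T i)

/-- The vertices in `S` can be coloured with `c` colours so that every connected monochromatic
subset of `S` has at most `g` vertices. -/
def ColourableOn (G : SimpleGraph V) (S : Set V) (c g : ℕ) : Prop :=
  ∃ f : V → ℕ, (∀ v ∈ S, f v < c) ∧
    ∀ U ⊆ S, Conn G U → (∀ u ∈ U, ∀ w ∈ U, f u = f w) → U.ncard ≤ g

/-- The number of colours used for the weak closure of a tree with `n + 1` levels. -/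
def colours : ℕ → ℕ
  | 0 => 0
  | n + 1 => 2 * (2 * colours n + 1)

variable {G : SimpleGraph V}

lemma Touch.symm {A B : Set V} (h : Touch G A B) : Touch G B A := by
  obtain ⟨a, ha, b, hb, hab⟩ := h
  exact ⟨b, hb, a, ha, hab.symm⟩

lemma Touch.mono {A B A' B' : Set V} (h : Touch G A B) (hA : A ⊆ A') (hB : B ⊆ B') :
    Touch G A' B' := by
  obtain ⟨a, ha, b, hb, hab⟩ := h
  exact ⟨a, hA ha, b, hB hb, hab⟩

/-- Connectedness may be checked on the cuts that leave a fixed vertex on the far side. -/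
lemma conn_of_mem {S : Set V} {s : V} (hs : s ∈ S)
    (h : ∀ U ⊆ S, U.Nonempty → s ∉ U → Touch G U (S \ U)) : Conn G S := by
  refine ⟨⟨s, hs⟩, fun U hU hne hne' => ?_⟩
  by_cases hsU : s ∈ U
  · have := h (S \ U) Set.sdiff_subset hne' (fun h => h.2 hsU)
    rw [Set.sdiff_sdiff_cancel_left hU] at this
    exact this.symm
  · exact h U hU hne hsU

lemma Conn.touch_of_notMem {S U : Set V} {s : V} (h : Conn G S) (hs : s ∈ S) (hU : U ⊆ S)
    (hne : U.Nonempty) (hsU : s ∉ U) : Touch G U (S \ U) :=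
  h.2 U hU hne ⟨s, hs, hsU⟩

lemma conn_singleton (v : V) : Conn G {v} := by
  refine conn_of_mem (Set.mem_singleton v) fun U hU hne hv => ?_
  obtain ⟨u, hu⟩ := hne
  exact absurd (hU hu ▸ hu) hv

lemma Conn.union {S T : Set V} {s : V} (hS : Conn G S) (hT : Conn G T) (h : s ∈ S) (h' : s ∈ T) :
    Conn G (S ∪ T) := by
  refine conn_of_mem (Or.inl h) fun U hU hne hsU => ?_
  obtain ⟨u, hu⟩ := hne
  rcases hU hu with hu' | hu'
  · refine (hS.touch_of_notMem h Set.inter_subset_right ⟨u, hu, hu'⟩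
      (fun h => hsU h.1)).mono (Set.inter_subset_left (s := U)) ?_
    rintro x ⟨hx, hx'⟩
    exact ⟨Or.inl hx, fun h => hx' ⟨h, hx⟩⟩
  · refine (hT.touch_of_notMem h' Set.inter_subset_right ⟨u, hu, hu'⟩
      (fun h => hsU h.1)).mono (Set.inter_subset_left (s := U)) ?_
    rintro x ⟨hx, hx'⟩
    exact ⟨Or.inr hx, fun h => hx' ⟨h, hx⟩⟩

lemma Conn.induce_connected {S : Set V} (h : Conn G S) : (G.induce S).Connected := by
  obtain ⟨s, hs⟩ := h.1
  have key : ∀ v : S, (G.induce S).Reachable ⟨s, hs⟩ v := by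
    by_contra! hcon
    obtain ⟨v, hv⟩ := hcon
    obtain ⟨a, ⟨ha, har⟩, b, ⟨hb, hb'⟩, hab⟩ := h.2
      {x | ∃ hx : x ∈ S, (G.induce S).Reachable ⟨s, hs⟩ ⟨x, hx⟩}
      (fun x hx => hx.1) ⟨s, hs, .rfl⟩ ⟨v, v.2, fun h => hv h.2⟩
    exact hb' ⟨hb, har.trans (SimpleGraph.Adj.reachable (by simpa using hab))⟩
  have : Nonempty S := ⟨⟨s, hs⟩⟩
  exact ⟨fun u v => (key u).symm.trans (key v)⟩

/-- A connected set with at least two vertices splits off a connected part next to `s`. -/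
lemma Conn.exists_branch [Finite V] {P : Set V} {s : V} (hP : Conn G P) (hs : s ∈ P)
    (hne : (P \ {s}).Nonempty) :
    ∃ C ⊆ P \ {s}, Conn G C ∧ Conn G (P \ C) ∧ ∃ c ∈ C, G.Adj s c := by
  obtain ⟨C, hC⟩ := (Set.toFinite
    {C : Set V | C ⊆ P \ {s} ∧ C.Nonempty ∧ ¬ Touch G C ((P \ {s}) \ C)}).exists_minimal
    ⟨P \ {s}, subset_rfl, hne, by rintro ⟨a, -, b, ⟨hb, hb'⟩, -⟩; exact hb' hb⟩
  obtain ⟨⟨hCP, hCne, hCt⟩, hmin⟩ := hC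
  have hsC : s ∉ C := fun h => (hCP h).2 rfl
  refine ⟨C, hCP, ⟨hCne, fun U hU hUne hne' => ?_⟩, ?_, ?_⟩
  · by_contra hcon
    have : C ⊆ U := hmin (y := U) ⟨hU.trans hCP, hUne, by
      rintro ⟨a, ha, b, ⟨hb, hb'⟩, hab⟩
      by_cases hbC : b ∈ C
      · exact hcon ⟨a, ha, b, ⟨hbC, hb'⟩, hab⟩
      · exact hCt ⟨a, hU ha, b, ⟨hb, hbC⟩, hab⟩⟩ hU
    obtain ⟨x, hx, hx'⟩ := hne'
    exact hx' (this hx)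
  · refine conn_of_mem ⟨hs, hsC⟩ fun U hU hUne hsU => ?_
    obtain ⟨a, ha, b, ⟨hb, hb'⟩, hab⟩ :=
      hP.touch_of_notMem hs (hU.trans Set.sdiff_subset) hUne hsU
    refine ⟨a, ha, b, ⟨⟨hb, fun hbC => ?_⟩, hb'⟩, hab⟩
    exact hCt ⟨b, hbC, a, ⟨⟨(hU ha).1, fun h => hsU (h ▸ ha)⟩, (hU ha).2⟩, hab.symm⟩
  · obtain ⟨a, ha, b, ⟨hb, hb'⟩, hab⟩ :=
      hP.touch_of_notMem hs (hCP.trans Set.sdiff_subset) hCne hsC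
    by_cases hbs : b = s
    · exact ⟨a, ha, hbs ▸ hab.symm⟩
    · exact absurd ⟨a, ha, b, ⟨⟨hb, hbs⟩, hb'⟩, hab⟩ hCt

/-- If every cover of a connected set by four sets has a big member, then the set contains two
big connected sets that share at most one vertex. -/
lemma Conn.exists_big_pair [Finite V] {A : Set V} (hA : Conn G A) {Big : Set V → Prop}
    (hempty : ¬ Big ∅)
    (hcover : ∀ P₁ P₂ P₃ P₄, A ⊆ P₁ ∪ P₂ ∪ (P₃ ∪ P₄) → Big P₁ ∨ Big P₂ ∨ Big P₃ ∨ Big P₄) :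
    ∃ P ⊆ A, ∃ Q ⊆ A, Conn G P ∧ Conn G Q ∧ Big P ∧ Big Q ∧ ∃ v, P ∩ Q ⊆ {v} := by
  obtain ⟨S, ⟨hSA, hS, s, hsS, hAS, hnb⟩, hminS⟩ := (Set.toFinite
    {S : Set V | S ⊆ A ∧ Conn G S ∧ ∃ s ∈ S, Conn G (A \ S ∪ {s}) ∧ ¬ Big (A \ S)}).exists_minimal
    (by
      obtain ⟨a, ha⟩ := hA.1
      exact ⟨A, subset_rfl, hA, a, ha, by simpa using conn_singleton a, by simpa using hempty⟩)
  have hSbig : Big S := by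
    rcases hcover S (A \ S) ∅ ∅ (by intro x hx; by_cases hxS : x ∈ S <;> simp [hx, hxS])
      with h | h | h | h
    exacts [h, absurd h hnb, absurd h hempty, absurd h hempty]
  obtain ⟨P, ⟨hPS, hsP, hP, hSP, hPbig⟩, hminP⟩ := (Set.toFinite
    {P : Set V | P ⊆ S ∧ s ∈ P ∧ Conn G P ∧ Conn G (S \ P ∪ {s}) ∧ Big P}).exists_minimal
    ⟨S, subset_rfl, hsS, hS, by simpa using conn_singleton s, hSbig⟩
  by_cases hne : (P \ {s}).Nonempty
  · obtain ⟨C, hCP, hC, hPC, c, hcC, hsc⟩ := hP.exists_branch hsP hne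
    have hsC : s ∉ C := fun h => (hCP h).2 rfl
    have hCs : Conn G (C ∪ {s}) := by
      refine conn_of_mem (s := s) (Or.inr rfl) fun U hU hUne hsU => ?_
      have hUC : U ⊆ C := fun x hx => (hU hx).resolve_right fun h => hsU (h ▸ hx)
      by_cases hcU : c ∈ U
      · exact ⟨c, hcU, s, ⟨Or.inr rfl, hsU⟩, hsc.symm⟩
      · exact (hC.touch_of_notMem hcC hUC hUne hcU).mono subset_rfl
          (Set.sdiff_subset_sdiff_left Set.subset_union_left)
    have hAC : Conn G (A \ C) := by
      have h1 := (hAS.union hSP (s := s) (Or.inr rfl) (Or.inr rfl)).union hPC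
        (s := s) (Or.inl (Or.inr rfl)) ⟨hsP, hsC⟩
      convert h1 using 1
      ext x
      have h2 := @hSA x
      have h3 := @hPS x
      have h4 := @hCP x
      have h5 := @hSA s hsS
      simp only [Set.mem_sdiff, Set.mem_union, Set.mem_singleton_iff] at *
      by_cases hxs : x = s
      · subst hxs; tauto
      · tauto
    have hCA : C ⊆ A := fun x hx => hSA (hPS (hCP hx).1)
    by_cases hCbig : Big C
    · by_cases hACbig : Big (A \ C)
      · exact ⟨C, hCA, A \ C, Set.sdiff_subset, hC, hAC, hCbig, hACbig, s, by simp⟩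
      · exfalso
        refine hsC (hminS (y := C) ⟨hCA, hC, c, hcC, ?_, hACbig⟩
          (fun x hx => hPS (hCP hx).1) hsS)
        have hsAC : s ∈ A \ C := ⟨hSA hsS, hsC⟩
        refine conn_of_mem (s := s) (Or.inl hsAC) fun U hU hUne hsU => ?_
        by_cases hcU : c ∈ U
        · exact ⟨c, hcU, s, ⟨Or.inl hsAC, hsU⟩, hsc.symm⟩
        · have hUC : U ⊆ A \ C := fun x hx => (hU hx).resolve_right fun h => hcU (h ▸ hx)
          exact (hAC.touch_of_notMem hsAC hUC hUne hsU).mono subset_rfl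
            (Set.sdiff_subset_sdiff_left Set.subset_union_left)
    · have hPCbig : ¬ Big (P \ C) := by
        intro hbig
        refine (hminP (y := P \ C) ⟨Set.sdiff_subset.trans hPS, ⟨hsP, hsC⟩, hPC, ?_, hbig⟩
          Set.sdiff_subset (hCP hcC).1).2 hcC
        have := hSP.union hCs (s := s) (Or.inr rfl) (Or.inr rfl)
        convert this using 1
        ext x
        have h3 := @hPS x
        have h4 := @hCP x
        simp only [Set.mem_sdiff, Set.mem_union, Set.mem_singleton_iff] at *
        tauto
      have hQbig : Big (S \ P ∪ {s}) := by
        rcases hcover (A \ S) (P \ C) C (S \ P ∪ {s}) (by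
          intro x hx
          simp only [Set.mem_sdiff, Set.mem_union, Set.mem_singleton_iff]
          tauto) with h | h | h | h
        exacts [absurd h hnb, absurd h hPCbig, absurd h hCbig, h]
      refine ⟨P, hPS.trans hSA, S \ P ∪ {s}, ?_, hP, hSP, hPbig, hQbig, s, ?_⟩
      · rintro x (hx | hx)
        exacts [hSA hx.1, hSA (hx ▸ hsS)]
      · rintro x ⟨hx, hx' | hx'⟩
        exacts [absurd hx hx'.2, hx']
  · refine ⟨P, hPS.trans hSA, S, hSA, hP, hS, hPbig, hSbig, s, fun x hx => ?_⟩
    by_contra hxs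
    exact hne ⟨x, hx.1, hxs⟩

lemma Model.mono {k k' n : ℕ} {Φ Φ' : Set V → Prop} {S S' : Set V} (h : Model G k n Φ S)
    (hk : k' ≤ k) (hS : S ⊆ S') (hΦ : ∀ B ⊆ S, Conn G B → Φ B → Φ' B) : Model G k' n Φ' S' := by
  induction n generalizing Φ Φ' S S' with
  | zero =>
    obtain ⟨B, hB, hBc, hBΦ⟩ := h
    exact ⟨B, hB.trans hS, hBc, hΦ B hB hBc hBΦ⟩
  | succ n ih =>
    obtain ⟨A, hA, hAc, T, hT, hTm⟩ := h
    refine ⟨A, hA.trans hS, hAc, fun i => T (Fin.castLE hk i),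
      fun i j hij => hT fun h => hij (Fin.castLE_injective hk h), fun i => ?_⟩
    obtain ⟨h1, h2⟩ := hTm (Fin.castLE hk i)
    exact ⟨h1.trans (Set.sdiff_subset_sdiff_left hS), ih h2 subset_rfl fun B hB hBc hB' =>
      ⟨hΦ B (hB.trans (h1.trans Set.sdiff_subset)) hBc hB'.1, hB'.2⟩⟩

lemma Model.exists_leaf {k n : ℕ} (hk : 1 ≤ k) {Φ : Set V → Prop} {S : Set V}
    (h : Model G k n Φ S) : ∃ B, Φ B := by
  induction n generalizing Φ S with
  | zero =>
    obtain ⟨B, -, -, hB⟩ := h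
    exact ⟨B, hB⟩
  | succ n ih =>
    obtain ⟨A, -, -, T, -, hT⟩ := h
    obtain ⟨B, hB⟩ := ih (hT ⟨0, hk⟩).2
    exact ⟨B, hB.1⟩

lemma model_succ_of_finset {ι : Type} {k n : ℕ} {Φ : Set V → Prop} {A S : Set V} (hA : A ⊆ S)
    (hAc : Conn G A) {T : ι → Set V} (hT : Pairwise fun i j => Disjoint (T i) (T j))
    {s : Finset ι} (hs : k ≤ s.card) (hTS : ∀ i ∈ s, T i ⊆ S \ A)
    (hm : ∀ i ∈ s, Model G k n (fun B => Φ B ∧ Touch G A B) (T i)) : Model G k (n + 1) Φ S := by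
  obtain ⟨t, hts, htc⟩ := Finset.exists_subset_card_eq hs
  let e := t.equivFinOfCardEq htc
  refine ⟨A, hA, hAc, fun i => T (e.symm i), fun i j hij => hT fun h => hij ?_, fun i => ?_⟩
  · exact e.symm.injective (Subtype.ext h)
  · exact ⟨hTS _ (hts (e.symm i).2), hm _ (hts (e.symm i).2)⟩

lemma exists_finset_of_or {ι : Type} [Fintype ι] {k₁ k₂ : ℕ} (hι : k₁ + k₂ ≤ Fintype.card ι)
    {p q : ι → Prop} (h : ∀ i, p i ∨ q i) :
    (∃ s : Finset ι, k₁ ≤ s.card ∧ ∀ i ∈ s, p i) ∨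
      ∃ s : Finset ι, k₂ ≤ s.card ∧ ∀ i ∈ s, q i := by
  classical
  by_cases hc : k₁ ≤ (Finset.univ.filter p).card
  · exact Or.inl ⟨_, hc, by simp⟩
  · refine Or.inr ⟨Finset.univ.filter fun i => ¬ p i, ?_, fun i hi => ?_⟩
    · have := Finset.card_filter_add_card_filter_not (s := (Finset.univ : Finset ι)) p
      rw [Finset.card_univ] at this
      omega
    · exact (h i).resolve_left (by simpa using hi)

/-- Ramsey property of models with respect to their leaves. -/
lemma Model.or_of_or {k₁ k₂ n : ℕ} {Φ Ψ₁ Ψ₂ : Set V → Prop} {S : Set V}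
    (h : Model G (k₁ + k₂) n Φ S) (hΦ : ∀ B, Φ B → Ψ₁ B ∨ Ψ₂ B) :
    Model G k₁ n Ψ₁ S ∨ Model G k₂ n Ψ₂ S := by
  induction n generalizing Φ Ψ₁ Ψ₂ S with
  | zero =>
    obtain ⟨B, hB, hBc, hBΦ⟩ := h
    exact (hΦ B hBΦ).imp (fun h => ⟨B, hB, hBc, h⟩) (fun h => ⟨B, hB, hBc, h⟩)
  | succ n ih =>
    obtain ⟨A, hA, hAc, T, hT, hTm⟩ := h
    have key := fun i => ih (Ψ₁ := fun B => Ψ₁ B ∧ Touch G A B)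
      (Ψ₂ := fun B => Ψ₂ B ∧ Touch G A B) (hTm i).2
      fun B hB => (hΦ B hB.1).imp (fun h => ⟨h, hB.2⟩) (fun h => ⟨h, hB.2⟩)
    rcases exists_finset_of_or (k₁ := k₁) (k₂ := k₂) (by simp) key with ⟨s, hs, hm⟩ | ⟨s, hs, hm⟩
    · exact Or.inl (model_succ_of_finset hA hAc hT hs (fun i _ => (hTm i).1) hm)
    · exact Or.inr (model_succ_of_finset hA hAc hT hs (fun i _ => (hTm i).1) hm)

/-- A model of large arity contains two models of arity `k` that share at most one vertex. -/
lemma Model.exists_pair [Finite V] {k n : ℕ} (hk : 1 ≤ k) {S : Set V}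
    (h : Model G (8 * k) n (fun _ => True) S) :
    ∃ M ⊆ S, ∃ M' ⊆ S, Model G k n (fun _ => True) M ∧ Model G k n (fun _ => True) M' ∧
      ∃ v, M ∩ M' ⊆ {v} := by
  classical
  cases n with
  | zero =>
    obtain ⟨B, hB, ⟨⟨b, hb⟩, -⟩, -⟩ := h
    have hm : Model G k 0 (fun _ => True) {b} := ⟨{b}, subset_rfl, conn_singleton b, trivial⟩
    have hbS : {b} ⊆ S := by simpa using hB hb
    exact ⟨{b}, hbS, {b}, hbS, hm, hm, b, by simp⟩
  | succ n =>
    obtain ⟨A, hA, hAc, T, hT, hTm⟩ := h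
    let Big : Set V → Prop := fun P =>
      ∃ s : Finset (Fin (8 * k)), 2 * k ≤ s.card ∧ ∀ i ∈ s, Model G k n (Touch G P) (T i)
    obtain ⟨P, hPA, Q, hQA, hP, hQ, ⟨s, hs, hsm⟩, ⟨t, ht, htm⟩, v, hv⟩ :=
      hAc.exists_big_pair (Big := Big)
        (by
          rintro ⟨s, hs, hm⟩
          obtain ⟨i, hi⟩ := Finset.card_pos.1 (by omega : 0 < s.card)
          obtain ⟨B, a, ha, -⟩ := (hm i hi).exists_leaf hk
          exact ha)
        (by
          intro P₁ P₂ P₃ P₄ hcov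
          have hsplit : ∀ X Y B : Set V, Touch G (X ∪ Y) B → Touch G X B ∨ Touch G Y B := by
            rintro X Y B ⟨a, ha | ha, b, hb, hab⟩
            exacts [Or.inl ⟨a, ha, b, hb, hab⟩, Or.inr ⟨a, ha, b, hb, hab⟩]
          have key : ∀ i, (Model G k n (Touch G P₁) (T i) ∨ Model G k n (Touch G P₂) (T i)) ∨
              (Model G k n (Touch G P₃) (T i) ∨ Model G k n (Touch G P₄) (T i)) := by
            intro i
            have h1 : Model G (k + k + (k + k)) n (Touch G (P₁ ∪ P₂ ∪ (P₃ ∪ P₄))) (T i) :=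
              (hTm i).2.mono (by omega) subset_rfl fun B _ _ hB => hB.2.mono hcov subset_rfl
            exact (h1.or_of_or (hsplit _ _)).imp (fun h => h.or_of_or (hsplit _ _))
              (fun h => h.or_of_or (hsplit _ _))
          have sub : ∀ {p q : Fin (8 * k) → Prop} (s : Finset (Fin (8 * k))), 4 * k ≤ s.card →
              (∀ i ∈ s, p i ∨ q i) → (∃ t : Finset (Fin (8 * k)), 2 * k ≤ t.card ∧ ∀ i ∈ t, p i) ∨
              ∃ t : Finset (Fin (8 * k)), 2 * k ≤ t.card ∧ ∀ i ∈ t, q i := by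
            intro p q s hs hpq
            have := exists_finset_of_or (ι := s) (k₁ := 2 * k) (k₂ := 2 * k)
              (p := fun i => p i) (q := fun i => q i) (by simp; omega) fun i => hpq i i.2
            refine this.imp ?_ ?_ <;>
            · rintro ⟨t, ht, htp⟩
              refine ⟨t.map (Function.Embedding.subtype _), by simpa using ht, fun i hi => ?_⟩
              obtain ⟨j, hj, rfl⟩ := Finset.mem_map.1 hi
              exact htp j hj
          rcases exists_finset_of_or (k₁ := 4 * k) (k₂ := 4 * k) (by simp; omega) key
            with ⟨s, hs, hm⟩ | ⟨s, hs, hm⟩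
          · rcases sub s hs hm with h | h
            exacts [Or.inl h, Or.inr (Or.inl h)]
          · rcases sub s hs hm with h | h
            exacts [Or.inr (Or.inr (Or.inl h)), Or.inr (Or.inr (Or.inr h))])
    obtain ⟨s', hs's, hs'⟩ := Finset.exists_subset_card_eq (by omega : k ≤ s.card)
    have ht' : k ≤ (t \ s').card := by
      have := Finset.le_card_sdiff s' t
      omega
    have hTA : ∀ i, Disjoint A (T i) := fun i =>
      Set.disjoint_left.2 fun x hx hxT => ((hTm i).1 hxT).2 hx
    have build : ∀ (R : Set V) (r : Finset (Fin (8 * k))), R ⊆ A → Conn G R → k ≤ r.card →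
        (∀ i ∈ r, Model G k n (Touch G R) (T i)) →
        R ∪ ⋃ i ∈ r, T i ⊆ S ∧ Model G k (n + 1) (fun _ => True) (R ∪ ⋃ i ∈ r, T i) := by
      intro R r hRA hR hr hm
      refine ⟨Set.union_subset (hRA.trans hA) (Set.iUnion₂_subset fun i _ =>
        (hTm i).1.trans Set.sdiff_subset), ?_⟩
      refine model_succ_of_finset Set.subset_union_left hR hT hr (fun i hi x hx => ?_)
        fun i hi => by simpa using hm i hi
      exact ⟨Or.inr (Set.mem_biUnion hi hx), fun h => Set.disjoint_left.1 (hTA i) (hRA h) hx⟩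
    obtain ⟨h1, h2⟩ := build P s' hPA hP hs'.ge fun i hi => hsm i (hs's hi)
    obtain ⟨h3, h4⟩ := build Q (t \ s') hQA hQ ht' fun i hi => htm i (Finset.sdiff_subset hi)
    refine ⟨_, h1, _, h3, h2, h4, v, ?_⟩
    rintro x ⟨hx | hx, hx' | hx'⟩
    · exact hv ⟨hx, hx'⟩
    · obtain ⟨i, -, hi⟩ := Set.mem_iUnion₂.1 hx'
      exact absurd hi (Set.disjoint_left.1 (hTA i) (hPA hx))
    · obtain ⟨i, -, hi⟩ := Set.mem_iUnion₂.1 hx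
      exact absurd hi (Set.disjoint_left.1 (hTA i) (hQA hx'))
    · obtain ⟨i, hi, hxi⟩ := Set.mem_iUnion₂.1 hx
      obtain ⟨j, hj, hxj⟩ := Set.mem_iUnion₂.1 hx'
      have hij : i ≠ j := fun h => (Finset.mem_sdiff.1 hj).2 (h ▸ hi)
      exact absurd hxj (Set.disjoint_left.1 (hT hij) hxi)

lemma ColourableOn.mono {S : Set V} {c c' g g' : ℕ} (h : ColourableOn G S c g) (hc : c ≤ c')
    (hg : g ≤ g') : ColourableOn G S c' g' := by
  obtain ⟨f, hf, hU⟩ := h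
  exact ⟨f, fun v hv => (hf v hv).trans_le hc, fun U h1 h2 h3 => (hU U h1 h2 h3).trans hg⟩

lemma ColourableOn.union {S T : Set V} {c d g : ℕ} (hS : ColourableOn G S c g)
    (hT : ColourableOn G T d g) : ColourableOn G (S ∪ T) (c + d) g := by
  classical
  obtain ⟨f, hf, hfU⟩ := hS
  obtain ⟨f', hf', hfU'⟩ := hT
  refine ⟨fun v => if v ∈ S then f v else c + f' v, fun v hv => ?_, fun U hU hUc hmon => ?_⟩
  · by_cases hvS : v ∈ S
    · simpa [hvS] using (hf v hvS).trans_le (Nat.le_add_right c d)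
    · simpa [hvS] using hf' v (hv.resolve_left hvS)
  · obtain ⟨u, hu⟩ := hUc.1
    by_cases huS : u ∈ S
    · have hUS : U ⊆ S := by
        intro w hw
        by_contra hwS
        have h1 := hmon u hu w hw
        have h2 := hf u huS
        simp only [huS, hwS, if_true, if_false] at h1
        omega
      exact hfU U hUS hUc fun x hx y hy => by simpa [hUS hx, hUS hy] using hmon x hx y hy
    · have hUS : ∀ w ∈ U, w ∉ S := by
        intro w hw hwS
        have h1 := hmon u hu w hw
        have h2 := hf w hwS
        simp only [huS, hwS, if_true, if_false] at h1
        omega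
      exact hfU' U (fun w hw => (hU hw).resolve_left (hUS w hw)) hUc fun x hx y hy => by
        simpa [hUS x hx, hUS y hy] using hmon x hx y hy

lemma colourableOn_of_ncard_le [Finite V] {S : Set V} {g : ℕ} (h : S.ncard ≤ g) :
    ColourableOn G S 1 g :=
  ⟨fun _ => 0, fun _ _ => one_pos, fun _ hU _ _ => (Set.ncard_le_ncard hU).trans h⟩

/-- Colourings of the fibres of `p` combine with a parity `b` that separates adjacent fibres. -/
lemma colourableOn_of_fibres {ι : Type} {S : Set V} {c g : ℕ} (p : V → ι) (b : V → ℕ)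
    (hb : ∀ v, b v < 2)
    (hadj : ∀ u ∈ S, ∀ w ∈ S, G.Adj u w → b u = b w → p u = p w)
    (hfib : ∀ i, ColourableOn G {v | v ∈ S ∧ p v = i} c g) : ColourableOn G S (2 * c) g := by
  choose f hf hfU using hfib
  refine ⟨fun v => b v + 2 * f (p v) v, fun v hv => ?_, fun U hU hUc hmon => ?_⟩
  · have := hf (p v) v ⟨hv, rfl⟩
    have := hb v
    dsimp only
    omega
  · have hmon' : ∀ u ∈ U, ∀ w ∈ U, b u = b w ∧ f (p u) u = f (p w) w := by
      intro u hu w hw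
      have h1 := hmon u hu w hw
      have h2 := hb u
      have h3 := hb w
      dsimp only at h1
      omega
    obtain ⟨u, hu⟩ := hUc.1
    have hp : ∀ w ∈ U, p w = p u := by
      by_contra! hcon
      obtain ⟨w, hw, hwp⟩ := hcon
      obtain ⟨x, hx, y, hy, hxy⟩ := hUc.2 {x ∈ U | p x = p u} (Set.sep_subset _ _)
        ⟨u, hu, rfl⟩ ⟨w, hw, fun h => hwp h.2⟩
      exact hy.2 ⟨hy.1, (hadj x (hU hx.1) y (hU hy.1) hxy (hmon' x hx.1 y hy.1).1) ▸ hx.2⟩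
    refine hfU (p u) U (fun w hw => ⟨hU hw, hp w hw⟩) hUc fun x hx y hy => ?_
    have := (hmon' x hx y hy).2
    rwa [hp x hx, hp y hy] at this

/-- Every vertex set carries a breadth-first layering: `ρ` records the root of the component and
`d` the distance to it. -/
lemma exists_layering (G : SimpleGraph V) (S : Set V) : ∃ (ρ : V → V) (d : V → ℕ),
    (∀ u ∈ S, ∀ w ∈ S, G.Adj u w → ρ u = ρ w ∧ d u ≤ d w + 1) ∧
    (∀ v ∈ S, d v = 0 → v = ρ v) ∧
    (∀ v ∈ S, ρ v ∈ S ∧ ρ (ρ v) = ρ v ∧ d (ρ v) = 0) ∧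
    (∀ v ∈ S, d v ≠ 0 → ∃ w ∈ S, G.Adj w v ∧ d w + 1 = d v) := by
  let H : SimpleGraph V :=
    { Adj := fun u w => u ∈ S ∧ w ∈ S ∧ G.Adj u w
      symm := ⟨fun u w h => ⟨h.2.1, h.1, h.2.2.symm⟩⟩
      loopless := ⟨fun u h => h.2.2.ne rfl⟩ }
  let ρ : V → V := fun v => (H.connectedComponentMk v).out
  have hρ : ∀ v, H.Reachable (ρ v) v := fun v =>
    SimpleGraph.ConnectedComponent.exact (H.connectedComponentMk v).out_eq
  have hρeq : ∀ u v, H.Reachable u v → ρ u = ρ v := fun u v h => by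
    simp only [ρ, SimpleGraph.ConnectedComponent.sound h]
  refine ⟨ρ, fun v => H.dist (ρ v) v, ?_, ?_, ?_, ?_⟩
  · intro u hu w hw huw
    have hH : H.Adj w u := ⟨hw, hu, huw.symm⟩
    have he := hρeq u w hH.symm.reachable
    refine ⟨he, ?_⟩
    have h1 := (hρ w).dist_triangle_left u
    rw [SimpleGraph.dist_eq_one_iff_adj.2 hH] at h1
    simpa only [he] using h1
  · intro v hv h0
    exact ((hρ v).dist_eq_zero_iff.1 h0).symm
  · intro v hv
    have h1 := hρeq _ _ (hρ v)
    refine ⟨?_, h1, by simp only [h1, SimpleGraph.dist_self]⟩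
    by_cases hne : ρ v = v
    · rwa [hne]
    · obtain ⟨q⟩ := hρ v
      exact (q.adj_snd (SimpleGraph.Walk.not_nil_of_ne hne)).1
  · intro v hv h0
    obtain ⟨q, hq⟩ := (hρ v).exists_walk_length_eq_dist
    have hnil : ¬ q.Nil := fun hn => h0 (hq.symm.trans (SimpleGraph.Walk.length_eq_zero_iff.2 hn))
    have hadj : H.Adj q.penultimate v := q.adj_penultimate hnil
    have hlen : q.dropLast.length + 1 = q.length := by
      rw [← SimpleGraph.Walk.length_concat _ hadj, q.concat_dropLast hadj]
    have hle := SimpleGraph.dist_le q.dropLast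
    have he := hρeq _ _ hadj.reachable
    refine ⟨q.penultimate, hadj.1, hadj.2.2, ?_⟩
    have htri := (hρ q.penultimate).dist_triangle_left v
    rw [SimpleGraph.dist_eq_one_iff_adj.2 hadj, he] at htri
    simp only [he]
    omega

/-- Either `r + 1` disjoint models, or a colouring with twice the colours plus one. -/
lemma exists_models_or_colourableOn {n c : ℕ}
    (hn : ∀ k, 1 ≤ k → ∃ g, ∀ (V : Type) [Finite V] (G : SimpleGraph V) (S : Set V),
      Model G k n (fun _ => True) S ∨ ColourableOn G S c g) (r : ℕ) :
    ∀ k, 1 ≤ k → ∃ g, ∀ (V : Type) [Finite V] (G : SimpleGraph V) (S : Set V),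
      (∃ T : Fin (r + 1) → Set V, (Pairwise fun i j => Disjoint (T i) (T j)) ∧
        ∀ i, T i ⊆ S ∧ Model G k n (fun _ => True) (T i)) ∨
      ColourableOn G S (2 * c + 1) g := by
  induction r with
  | zero =>
    intro k hk
    obtain ⟨g, hg⟩ := hn k hk
    refine ⟨g, fun V _ G S => (hg V G S).imp (fun h => ⟨fun _ => S, fun i j hij => ?_,
      fun _ => ⟨subset_rfl, h⟩⟩) (fun h => h.mono (by omega) le_rfl)⟩
    exact absurd (Fin.ext (by omega)) hij
  | succ r ih =>
    intro k hk
    obtain ⟨g₁, hg₁⟩ := ih (8 * k) (by omega)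
    obtain ⟨g₀, hg₀⟩ := hn k hk
    refine ⟨max g₁ (max g₀ (r + 1)), fun V _ G S => ?_⟩
    rcases hg₁ V G S with ⟨T, hT, hTm⟩ | h
    · choose M hM M' hM' hMm hMm' v hv using fun i => (hTm i).2.exists_pair hk
      have extend : ∀ (N : Set V) (L : Fin (r + 1) → Set V), (∀ i, L i ⊆ T i) →
          (∀ i, Model G k n (fun _ => True) (L i)) → N ⊆ S → (∀ i, Disjoint N (L i)) →
          Model G k n (fun _ => True) N →
          ∃ T : Fin (r + 1 + 1) → Set V, (Pairwise fun i j => Disjoint (T i) (T j)) ∧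
            ∀ i, T i ⊆ S ∧ Model G k n (fun _ => True) (T i) := by
        intro N L hL hLm hNS hNL hN
        refine ⟨Fin.cons N L, fun i j hij => ?_, fun i => ?_⟩
        · induction i using Fin.cases with
          | zero =>
            induction j using Fin.cases with
            | zero => exact absurd rfl hij
            | succ j => simpa using hNL j
          | succ i =>
            induction j using Fin.cases with
            | zero => simpa using (hNL i).symm
            | succ j =>
              simpa using (hT fun h => hij (congrArg Fin.succ h)).mono (hL i) (hL j)
        · induction i using Fin.cases with
          | zero => exact ⟨by simpa using hNS, by simpa using hN⟩
          | succ i => exact ⟨by simpa using (hL i).trans (hTm i).1, by simpa using hLm i⟩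
      have hXS : ⋃ i, M i ⊆ S := Set.iUnion_subset fun i => (hM i).trans (hTm i).1
      rcases hg₀ V G (S \ ⋃ i, M i) with h | hc
      · exact Or.inl (extend _ M hM hMm Set.sdiff_subset (fun i => Set.disjoint_left.2
          fun x hx hxi => hx.2 (Set.mem_iUnion.2 ⟨i, hxi⟩)) h)
      rcases hg₀ V G ((⋃ i, M i) \ Set.range v) with h | hc'
      · refine Or.inl (extend _ M' hM' hMm' (Set.sdiff_subset.trans hXS) (fun i =>
          Set.disjoint_left.2 ?_) h)
        rintro x ⟨hx, hxv⟩ hxi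
        obtain ⟨j, hj⟩ := Set.mem_iUnion.1 hx
        by_cases hij : j = i
        · subst hij
          exact hxv ⟨j, (hv j ⟨hj, hxi⟩).symm⟩
        · exact Set.disjoint_left.1 (hT hij) (hM j hj) (hM' i hxi)
      · right
        have hcv : ColourableOn G (S ∩ Set.range v) 1 (max g₁ (max g₀ (r + 1))) := by
          refine colourableOn_of_ncard_le
            ((Set.ncard_le_ncard Set.inter_subset_right).trans ?_)
          have : (Set.range v).ncard ≤ r + 1 := by
            rw [← Set.image_univ]
            exact (Set.ncard_image_le).trans (by simp [Set.ncard_univ])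
          omega
        have := ((hc.mono le_rfl (by omega)).union (hc'.mono le_rfl (by omega))).union hcv
        have hS : S \ (⋃ i, M i) ∪ (⋃ i, M i) \ Set.range v ∪ S ∩ Set.range v = S := by
          ext x
          have := @hXS x
          simp only [Set.mem_union, Set.mem_sdiff, Set.mem_inter_iff]
          tauto
        rw [hS] at this
        exact this.mono (by omega) le_rfl
    · exact Or.inr (h.mono le_rfl (le_max_left _ _))

lemma model_or_colourableOn (n : ℕ) :
    ∀ k, 1 ≤ k → ∃ g, ∀ (V : Type) [Finite V] (G : SimpleGraph V) (S : Set V),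
      Model G k n (fun _ => True) S ∨ ColourableOn G S (colours n) g := by
  induction n with
  | zero =>
    refine fun k _ => ⟨0, fun V _ G S => ?_⟩
    rcases S.eq_empty_or_nonempty with rfl | ⟨s, hs⟩
    · exact Or.inr ⟨fun _ => 0, by simp, fun U hU _ _ => by
        simp [Set.subset_empty_iff.1 hU]⟩
    · exact Or.inl ⟨{s}, by simpa using hs, conn_singleton s, trivial⟩
  | succ n ih =>
    intro k hk
    obtain ⟨r, rfl⟩ := Nat.exists_eq_add_of_le' hk
    obtain ⟨g, hg⟩ := exists_models_or_colourableOn ih r (r + 1) hk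
    refine ⟨max g 1, fun V _ G S => ?_⟩
    by_contra! hcon
    obtain ⟨hmodel, hcol⟩ := hcon
    obtain ⟨ρ, d, hadj, hzero, hroot, hpred⟩ := exists_layering G S
    refine hcol (colourableOn_of_fibres (fun v => (ρ v, d v)) (fun v => d v % 2)
      (fun v => Nat.mod_lt _ two_pos) (fun u hu w hw huw hpar => ?_) ?_)
    · have h1 := hadj u hu w hw huw
      have h2 := hadj w hw u hu huw.symm
      exact Prod.ext h1.1 (by dsimp only at *; omega)
    · rintro ⟨x, i⟩
      rcases Nat.eq_zero_or_pos i with rfl | hi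
      · refine (colourableOn_of_ncard_le (g := 1) ?_).mono (by omega) (le_max_right _ _)
        rw [← Set.ncard_singleton x]
        refine Set.ncard_le_ncard ?_
        rintro v ⟨hvS, hv⟩
        rw [Prod.mk.injEq] at hv
        exact (hzero v hvS hv.2).trans hv.1
      · rcases hg V G {v | v ∈ S ∧ (ρ v, d v) = (x, i)} with ⟨T, hT, hTm⟩ | h
        · exfalso
          apply hmodel
          have hpred' : ∀ v ∈ S, ρ v = x → d v ≠ 0 →
              ∃ w ∈ S, ρ w = x ∧ G.Adj v w ∧ d w + 1 = d v := by
            intro v hv hvx hv0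
            obtain ⟨w, hw, hwv, hd⟩ := hpred v hv hv0
            exact ⟨w, hw, (hadj w hw v hv hwv).1.trans hvx, hwv.symm, hd⟩
          obtain ⟨v₀, hv₀⟩ : ∃ v, v ∈ S ∧ ρ v = x := by
            have hne : (T 0).Nonempty := by
              rcases n with _ | n <;>
              · obtain ⟨B, hB, hBc, -⟩ := (hTm 0).2
                exact hBc.1.mono hB
            obtain ⟨v, hv⟩ := hne
            have := (hTm 0).1 hv
            exact ⟨v, this.1, congrArg Prod.fst this.2⟩
          have hR : Conn G {v | v ∈ S ∧ ρ v = x ∧ d v < i} := by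
            have hx := hroot v₀ hv₀.1
            rw [hv₀.2] at hx
            refine conn_of_mem (s := x) ⟨hx.1, hx.2.1, by omega⟩ fun U hU hUne hxU => ?_
            obtain ⟨u, hu, hmin⟩ := exists_minimal_of_wellFoundedLT
              (fun m => ∃ u ∈ U, d u = m) (by obtain ⟨u, hu⟩ := hUne; exact ⟨d u, u, hu, rfl⟩)
            obtain ⟨u, hu, rfl⟩ := hu
            obtain ⟨huS, hux, hui⟩ := hU hu
            have hu0 : d u ≠ 0 := fun h0 => hxU (hux ▸ hzero u huS h0 ▸ hu)
            obtain ⟨w, hw, hwx, huw, hd⟩ := hpred' u huS hux hu0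
            refine ⟨u, hu, w, ⟨⟨hw, hwx, by omega⟩, fun hwU => ?_⟩, huw⟩
            have := hmin ⟨w, hwU, rfl⟩ (by omega)
            omega
          refine ⟨_, fun v hv => hv.1, hR, T, hT, fun j => ⟨fun v hv => ?_, ?_⟩⟩
          · have := (hTm j).1 hv
            refine ⟨this.1, fun h => ?_⟩
            have h2 := congrArg Prod.snd this.2
            exact absurd h.2.2 (by dsimp only at h2; omega)
          · refine (hTm j).2.mono le_rfl subset_rfl fun B hB hBc _ => ⟨trivial, ?_⟩
            obtain ⟨b, hb⟩ := hBc.1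
            obtain ⟨hbS, hbx⟩ := (hTm j).1 (hB hb)
            rw [Prod.mk.injEq] at hbx
            obtain ⟨w, hw, hwx, hbw, hd⟩ := hpred' b hbS hbx.1 (by omega)
            exact ⟨w, ⟨hw, hwx, by omega⟩, b, hb, hbw.symm⟩
        · exact h.mono le_rfl (le_max_left _ _)

lemma Model.exists_branchSets {k n : ℕ} {Φ : Set V → Prop} {S : Set V} (h : Model G k n Φ S) :
    ∃ X : List (Fin k) → Set V,
      (∀ l, l.length ≤ n → Conn G (X l) ∧ X l ⊆ S) ∧
      (∀ l m, l.length ≤ n → m.length ≤ n → l ≠ m → Disjoint (X l) (X m)) ∧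
      (∀ l m, m.length = n → l <+: m → l ≠ m → Touch G (X l) (X m)) ∧
      ∀ m, m.length = n → Φ (X m) := by
  induction n generalizing Φ S with
  | zero =>
    obtain ⟨B, hB, hBc, hBΦ⟩ := h
    refine ⟨fun _ => B, fun _ _ => ⟨hBc, hB⟩, fun l m hl hm hlm => ?_, fun l m hm hlm hne => ?_,
      fun _ _ => hBΦ⟩
    · rw [List.length_eq_zero_iff.1 (Nat.le_zero.1 hl),
        List.length_eq_zero_iff.1 (Nat.le_zero.1 hm)] at hlm
      exact absurd rfl hlm
    · rw [List.length_eq_zero_iff.1 hm] at hlm hne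
      exact absurd (List.prefix_nil.1 hlm) hne
  | succ n ih =>
    obtain ⟨A, hA, hAc, T, hT, hTm⟩ := h
    choose X hX hXd hXt hXΦ using fun i => ih (hTm i).2
    have hAX : ∀ i l, l.length ≤ n → Disjoint A (X i l) := fun i l hl =>
      Set.disjoint_left.2 fun x hx hx' => ((hTm i).1 ((hX i l hl).2 hx')).2 hx
    refine ⟨fun l => match l with
      | [] => A
      | i :: l => X i l, ?_, ?_, ?_, ?_⟩
    · rintro (_ | ⟨i, l⟩) hl
      · exact ⟨hAc, hA⟩
      · have hl' : l.length ≤ n := by simpa using hl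
        exact ⟨(hX i l hl').1, (hX i l hl').2.trans ((hTm i).1.trans Set.sdiff_subset)⟩
    · rintro (_ | ⟨i, l⟩) (_ | ⟨j, m⟩) hl hm hne
      · exact absurd rfl hne
      · exact hAX j m (by simpa using hm)
      · exact (hAX i l (by simpa using hl)).symm
      · have hl' : l.length ≤ n := by simpa using hl
        have hm' : m.length ≤ n := by simpa using hm
        by_cases hij : i = j
        · subst hij
          exact hXd i l m hl' hm' fun h => hne (h ▸ rfl)
        · exact (hT hij).mono (hX i l hl').2 (hX j m hm').2
    · rintro (_ | ⟨i, l⟩) (_ | ⟨j, m⟩) hm hlm hne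
      · exact absurd rfl hne
      · exact (hXΦ j m (by simpa using hm)).2
      · exact absurd (List.prefix_nil.1 hlm) hne
      · obtain ⟨rfl, hlm'⟩ := List.cons_prefix_cons.1 hlm
        exact hXt i l m (by simpa using hm) hlm' fun h => hne (h ▸ rfl)
    · rintro (_ | ⟨i, m⟩) hm
      · simp at hm
      · exact (hXΦ i m (by simpa using hm)).1

lemma Model.isMinor {k n : ℕ} (h : Model G k n (fun _ => True) Set.univ) :
    IsMinor (weakClosureTree (n + 1) k) G := by
  obtain ⟨X, hX, hXd, hXt, -⟩ := h.exists_branchSets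
  refine ⟨fun l => X l.1, fun l => (hX l.1 (Nat.lt_succ_iff.1 l.2)).1.induce_connected,
    fun l m hlm => hXd l.1 m.1 (Nat.lt_succ_iff.1 l.2) (Nat.lt_succ_iff.1 m.2)
      fun h => hlm (Subtype.ext h), fun l m hlm => ?_⟩
  rw [weakClosureTree, SimpleGraph.fromRel_adj] at hlm
  obtain ⟨hne, ⟨hlen, hpre⟩ | ⟨hlen, hpre⟩⟩ := hlm
  · exact hXt l.1 m.1 hlen hpre fun h => hne (Subtype.ext h)
  · exact (hXt m.1 l.1 hlen hpre fun h => hne (Subtype.ext h.symm)).symm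

lemma ColourableOn.clusteredColourable {c g : ℕ} (h : ColourableOn G Set.univ c g) :
    ClusteredColourable G c g := by
  obtain ⟨f, hf, hU⟩ := h
  refine ⟨fun v => ⟨f v, hf v trivial⟩, fun v => ?_⟩
  set F : V → Fin c := fun v => ⟨f v, hf v trivial⟩ with hF
  set C := (G.induce {u | F u = F v}).connectedComponentMk ⟨v, rfl⟩ with hC
  rw [← Set.ncard_image_of_injective _ Subtype.val_injective]
  refine hU _ (Set.subset_univ _) ?_ ?_
  · refine conn_of_mem (s := v) ⟨⟨v, rfl⟩, rfl, rfl⟩ fun U hUC hUne hvU => ?_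
    obtain ⟨u, hu⟩ := hUne
    obtain ⟨⟨u', hu'⟩, huC, rfl⟩ := hUC hu
    obtain ⟨q⟩ := (SimpleGraph.ConnectedComponent.exact huC)
    obtain ⟨e, he, h1, h2⟩ := q.exists_boundary_dart {x | x.1 ∈ U} hu hvU
    refine ⟨_, h1, _, ⟨⟨_, ?_, rfl⟩, h2⟩, e.adj⟩
    obtain ⟨y, hyC, hy⟩ := hUC h1
    have hy' : y = e.fst := Subtype.ext hy
    subst hy'
    exact (SimpleGraph.ConnectedComponent.sound e.adj.symm.reachable).trans hyC
  · rintro _ ⟨x, -, rfl⟩ _ ⟨y, -, rfl⟩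
    have := x.2.trans y.2.symm
    exact congrArg Fin.val this

lemma colours_eq (n : ℕ) : colours n = (4 ^ (n + 1) - 4) / 6 := by
  have : 6 * colours n + 4 = 4 ^ (n + 1) := by
    induction n with
    | zero => rfl
    | succ n ih =>
      rw [pow_succ, ← ih, colours]
      ring
  omega

end WeakClosure

open WeakClosure in
/-- With `f h = (4^h - 4)/6`, there is a function `g : ℕ × ℕ → ℕ` such
that for all `h, k ≥ 1`, every graph either contains `W(h,k)` as a minor or is
`f h`-colourable with clustering `g h k`. -/
theorem colour_or_weakClosureTree_minor :
    ∃ g : ℕ → ℕ → ℕ, ∀ h k : ℕ, 1 ≤ h → 1 ≤ k →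
      ∀ (V : Type) [Finite V] (G : SimpleGraph V),
        IsMinor (weakClosureTree h k) G ∨
        ClusteredColourable G ((4 ^ h - 4) / 6) (g h k) := by
  choose g hg using model_or_colourableOn
  refine ⟨fun h k => if hk : 1 ≤ k then g (h - 1) k hk else 0, fun h k hh hk V _ G => ?_⟩
  obtain ⟨n, rfl⟩ := Nat.exists_eq_add_of_le' hh
  rw [← colours_eq]
  simpa [hk] using (hg n k hk V G Set.univ).imp Model.isMinor
    ColourableOn.clusteredColourable
end

section
/- For every graph H there exists an integer c = c(H) ≥ 1 such that every H-minor-free graph is ((4^{ctd(H)} − 4)/6)-colourable with clustering c. -/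
/-- The vertices with a neighbour in `R`. -/
def openNbhd {V : Type*} (G : SimpleGraph V) (R : Set V) : Set V :=
  {v | ∃ u ∈ R, G.Adj u v}

/-- `HasClosureModel G n d 𝓡 S`: the set `S` contains a model in `G` of the closure of the complete
`n`-ary tree of depth `d`, all of whose branch sets meet every member of `𝓡`. -/
def HasClosureModel {V : Type*} (G : SimpleGraph V) (n : ℕ) : ℕ → Set (Set V) → Set V → Prop
  | 0, _, _ => True
  | d + 1, 𝓡, S => ∃ R ⊆ S, (G.induce R).Connected ∧ (∀ A ∈ 𝓡, (R ∩ A).Nonempty) ∧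
      ∃ D : Fin n → Set V, (∀ j, D j ⊆ S \ R) ∧ (Pairwise fun i j => Disjoint (D i) (D j)) ∧
        ∀ j, HasClosureModel G n d (insert (openNbhd G R) 𝓡) (D j)

/-- The set `S` can be coloured with `q` colours such that monochromatic connected subsets of `S`
have at most `c` vertices. -/
def ClusteredColourableOn {V : Type*} (G : SimpleGraph V) (S : Set V) (q c : ℕ) : Prop :=
  ∃ f : V → ℕ, (∀ v ∈ S, f v < q) ∧ ∀ T ⊆ S, (G.induce T).Connected →
    (∀ u ∈ T, ∀ v ∈ T, f u = f v) → T.ncard ≤ c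

section ClosureModels

variable {V : Type*} {G : SimpleGraph V}

lemma openNbhd_mono {R R' : Set V} (h : R ⊆ R') : openNbhd G R ⊆ openNbhd G R' :=
  fun _ ⟨u, hu, huv⟩ => ⟨u, h hu, huv⟩

lemma openNbhd_union (R R' : Set V) :
    openNbhd G (R ∪ R') = openNbhd G R ∪ openNbhd G R' := by
  ext v
  simp [openNbhd, or_and_right, exists_or]

lemma connected_union_of_meets_openNbhd {R R' : Set V} (hR : (G.induce R).Connected)
    (hR' : (G.induce R').Connected) (h : (R' ∩ openNbhd G R).Nonempty) :
    (G.induce (R ∪ R')).Connected := by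
  obtain ⟨v, hv, u, hu, huv⟩ := h
  exact SimpleGraph.connected_induce_union hR.preconnected hR'.preconnected hu hv huv

lemma HasClosureModel.mono {N t d : ℕ} (htN : t ≤ N) {𝓡 𝓡' : Set (Set V)} {S S' : Set V}
    (h𝓡 : ∀ A ∈ 𝓡', ∃ B ∈ 𝓡, B ⊆ A) (hS : S ⊆ S') (h : HasClosureModel G N d 𝓡 S) :
    HasClosureModel G t d 𝓡' S' := by
  induction d generalizing 𝓡 𝓡' S S' with
  | zero => trivial
  | succ d ih =>
    obtain ⟨R, hRS, hR, hmeet, D, hDS, hD, hmodel⟩ := h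
    refine ⟨R, hRS.trans hS, hR, fun A hA => ?_, fun j => D (Fin.castLE htN j),
      fun j => (hDS _).trans (Set.sdiff_subset_sdiff_left hS),
      fun i j hij => hD fun h => hij (Fin.castLE_injective htN h), fun j => ih ?_ subset_rfl
        (hmodel (Fin.castLE htN j))⟩
    · obtain ⟨B, hB, hBA⟩ := h𝓡 A hA
      exact (hmeet B hB).mono (Set.inter_subset_inter_right R hBA)
    · rintro A (rfl | hA)
      · exact ⟨_, Set.mem_insert _ _, subset_rfl⟩
      · obtain ⟨B, hB, hBA⟩ := h𝓡 A hA
        exact ⟨B, Set.mem_insert_of_mem _ hB, hBA⟩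

lemma HasClosureModel.mono_arity {N t d : ℕ} (htN : t ≤ N) {𝓡 : Set (Set V)} {S : Set V}
    (h : HasClosureModel G N d 𝓡 S) : HasClosureModel G t d 𝓡 S :=
  h.mono htN (fun A hA => ⟨A, hA, subset_rfl⟩) subset_rfl

lemma HasClosureModel.insert_of_subset {n d : ℕ} {𝓡 : Set (Set V)} {S A : Set V} (hSA : S ⊆ A)
    (h : HasClosureModel G n d 𝓡 S) : HasClosureModel G n d (insert A 𝓡) S := by
  induction d generalizing 𝓡 S with
  | zero => trivial
  | succ d ih =>
    obtain ⟨R, hRS, hR, hmeet, D, hDS, hD, hmodel⟩ := h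
    refine ⟨R, hRS, hR, ?_, D, hDS, hD, fun j => ?_⟩
    · rintro B (rfl | hB)
      · obtain ⟨v⟩ := hR.nonempty
        exact ⟨v, v.2, hSA (hRS v.2)⟩
      · exact hmeet B hB
    · rw [Set.insert_comm]
      exact ih ((hDS j).trans (Set.sdiff_subset.trans hSA)) (hmodel j)

/-- A root together with sufficiently many disjoint models that meet its neighbourhood. -/
lemma HasClosureModel.of_finset {ι : Type*} [LinearOrder ι] {t d : ℕ} {𝓡 : Set (Set V)}
    {R S : Set V} (hRS : R ⊆ S) (hR : (G.induce R).Connected) (hmeet : ∀ A ∈ 𝓡, (R ∩ A).Nonempty)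
    {D : ι → Set V} (J : Finset ι) (hJ : t ≤ J.card) (hDS : ∀ j ∈ J, D j ⊆ S \ R)
    (hD : Pairwise fun i j => Disjoint (D i) (D j))
    (hmodel : ∀ j ∈ J, HasClosureModel G t d (insert (openNbhd G R) 𝓡) (D j)) :
    HasClosureModel G t (d + 1) 𝓡 S := by
  have hmem := J.orderEmbOfCardLe_mem hJ
  exact ⟨R, hRS, hR, hmeet, fun j => D (J.orderEmbOfCardLe hJ j), fun j => hDS _ (hmem j),
    fun i j hij => hD fun h => hij ((J.orderEmbOfCardLe hJ).injective h),
    fun j => hmodel _ (hmem j)⟩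

lemma HasClosureModel.of_insert_of_many {N t d : ℕ} {𝓡 : Set (Set V)} {R S A : Set V}
    (hRS : R ⊆ S) (hR : (G.induce R).Connected) (hmeet : ∀ B ∈ 𝓡, (R ∩ B).Nonempty)
    {D : Fin N → Set V} (J : Finset (Fin N)) (hJ : t < J.card) (hDS : ∀ j, D j ⊆ S \ R)
    (hD : Pairwise fun i j => Disjoint (D i) (D j))
    (hmodel : ∀ j ∈ J,
      HasClosureModel G t (d + 1) (insert A (insert (openNbhd G R) 𝓡)) (D j)) :
    HasClosureModel G t (d + 2) (insert A 𝓡) S := by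
  obtain ⟨i, hi⟩ := Finset.card_pos.1 (Nat.zero_lt_of_lt hJ)
  obtain ⟨R₀, hR₀D, hR₀, hmeet₀, -⟩ := hmodel i hi
  refine .of_finset (R := R ∪ R₀) (D := D)
    (Set.union_subset hRS (hR₀D.trans ((hDS i).trans Set.sdiff_subset)))
    (connected_union_of_meets_openNbhd hR hR₀ (hmeet₀ _ (by simp))) ?_ (J.erase i)
    (by rw [Finset.card_erase_of_mem hi]; omega) ?_ hD ?_
  · rintro B (rfl | hB)
    · exact (hmeet₀ _ (by simp)).mono
        (Set.inter_subset_inter_left _ Set.subset_union_right)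
    · exact (hmeet B hB).mono (Set.inter_subset_inter_left _ Set.subset_union_left)
  · intro j hj v hv
    refine ⟨(hDS j hv).1, ?_⟩
    rintro (hvR | hvR)
    · exact (hDS j hv).2 hvR
    · exact Set.disjoint_left.1 (hD (Finset.ne_of_mem_erase hj)) hv (hR₀D hvR)
  · intro j hj
    refine (hmodel j (Finset.mem_of_mem_erase hj)).mono le_rfl ?_ subset_rfl
    rintro B (rfl | rfl | hB)
    · exact ⟨openNbhd G R, by simp, openNbhd_mono Set.subset_union_left⟩
    · exact ⟨_, by simp, subset_rfl⟩
    · exact ⟨B, by simp [hB], subset_rfl⟩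

lemma HasClosureModel.insert_left_or_insert_right {t d : ℕ} {𝓡 : Set (Set V)} {S A B : Set V}
    (h : HasClosureModel G (2 * t + 1) d (insert (A ∪ B) 𝓡) S) :
    HasClosureModel G t d (insert A 𝓡) S ∨ HasClosureModel G t d (insert B 𝓡) S := by
  classical
  induction d generalizing 𝓡 S with
  | zero => exact .inl trivial
  | succ d ih =>
    obtain ⟨R, hRS, hR, hmeet, D, hDS, hD, hmodel⟩ := h
    have hmeet' : ∀ C ∈ 𝓡, (R ∩ C).Nonempty := fun C hC => hmeet C (by simp [hC])
    cases d with
    | zero =>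
      have key : ∀ C : Set V, (R ∩ C).Nonempty → HasClosureModel G t 1 (insert C 𝓡) S := by
        intro C hC
        refine .of_finset (D := D) hRS hR ?_ Finset.univ (by simp; omega) (fun j _ => hDS j) hD
          fun _ _ => trivial
        rintro E (rfl | hE)
        exacts [hC, hmeet' E hE]
      have := hmeet (A ∪ B) (by simp)
      rw [Set.inter_union_distrib_left, Set.union_nonempty] at this
      exact this.imp (key A) (key B)
    | succ d =>
      have hor : ∀ j, HasClosureModel G t (d + 1) (insert A (insert (openNbhd G R) 𝓡)) (D j) ∨
          HasClosureModel G t (d + 1) (insert B (insert (openNbhd G R) 𝓡)) (D j) :=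
        fun j => ih (by rw [Set.insert_comm]; exact hmodel j)
      let J : Set V → Finset (Fin (2 * t + 1)) := fun C => Finset.univ.filter fun j =>
        HasClosureModel G t (d + 1) (insert C (insert (openNbhd G R) 𝓡)) (D j)
      have key : ∀ C : Set V, t < (J C).card →
          HasClosureModel G t (d + 2) (insert C 𝓡) S := fun C hC =>
        .of_insert_of_many hRS hR hmeet' (J C) hC hDS hD fun j hj => (Finset.mem_filter.1 hj).2
      have hcard : 2 * t + 1 ≤ (J A).card + (J B).card := by
        calc 2 * t + 1 = (Finset.univ : Finset (Fin (2 * t + 1))).card := by simp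
          _ ≤ (J A ∪ J B).card := Finset.card_le_card fun j _ => by
              simpa [J] using hor j
          _ ≤ _ := Finset.card_union_le _ _
      rcases Nat.lt_or_ge t (J A).card with hA | hA
      · exact .inl (key A hA)
      · exact .inr (key B (by omega))

end ClosureModels

section Splitting

variable {V : Type*} {G : SimpleGraph V}

lemma exists_adj_of_connected_induce {Q K : Set V} (hQ : (G.induce Q).Connected) {a b : V}
    (haQ : a ∈ Q) (haK : a ∈ K) (hbQ : b ∈ Q) (hbK : b ∉ K) :
    ∃ u ∈ Q, u ∈ K ∧ ∃ v ∈ Q, v ∉ K ∧ G.Adj u v := by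
  obtain ⟨p⟩ := hQ.preconnected ⟨a, haQ⟩ ⟨b, hbQ⟩
  obtain ⟨e, -, he₁, he₂⟩ := p.exists_boundary_dart (Subtype.val ⁻¹' K) haK hbK
  exact ⟨e.fst, e.fst.2, he₁, e.snd, e.snd.2, he₂, e.adj⟩

lemma connected_induce_singleton (x : V) : (G.induce {x}).Connected := by
  have : Subsingleton ({x} : Set V) := Set.subsingleton_coe _ |>.2 Set.subsingleton_singleton
  have : Nonempty ({x} : Set V) := ⟨⟨x, rfl⟩⟩
  exact ⟨fun u v => by rw [Subsingleton.elim u v]⟩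

lemma connected_induce_insert {K : Set V} (hK : (G.induce K).Connected) {u v : V} (hu : u ∈ K)
    (huv : G.Adj u v) : (G.induce (insert v K)).Connected := by
  rw [Set.insert_eq, Set.union_comm]
  exact SimpleGraph.connected_induce_union hK.preconnected
    (connected_induce_singleton v).preconnected hu rfl huv

lemma exists_maximal_connected_induce [Finite V] {Q : Set V} {z : V} (hz : z ∈ Q) :
    ∃ K ⊆ Q, z ∈ K ∧ (G.induce K).Connected ∧
      ∀ u ∈ K, ∀ v ∈ Q, G.Adj u v → v ∈ K := by
  obtain ⟨K, hzK, hK⟩ := Finite.exists_le_maximal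
    (p := fun K : Set V => K ⊆ Q ∧ (G.induce K).Connected) (a := {z}) ⟨by simpa using hz, connected_induce_singleton z⟩
  refine ⟨K, hK.prop.1, hzK rfl, hK.prop.2, fun u hu v hv huv => ?_⟩
  exact hK.le_of_ge ⟨Set.insert_subset hv hK.prop.1, connected_induce_insert hK.prop.2 hu huv⟩
    (Set.subset_insert v K) (Set.mem_insert v K)

/-- Removing a component of `Q \ {x}` from a connected set `Q` leaves a connected set. -/
lemma exists_connected_split_s7 [Finite V] {Q : Set V} (hQ : (G.induce Q).Connected) {x : V}
    (hx : x ∈ Q) (hne : Q ≠ {x}) :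
    ∃ K ⊆ Q, x ∉ K ∧ (G.induce K).Connected ∧ (G.induce (Q \ K)).Connected ∧
      ∃ y ∈ K, G.Adj x y := by
  obtain ⟨z, hz, hzx⟩ : ∃ z ∈ Q, z ≠ x := by
    by_contra! h
    exact hne (Set.eq_singleton_iff_unique_mem.2 ⟨hx, h⟩)
  obtain ⟨K, hKQ, hzK, hK, hKmax⟩ := exists_maximal_connected_induce (G := G) (Q := Q \ {x})
    (z := z) ⟨hz, hzx⟩
  have hxK : x ∉ K := fun h => (hKQ h).2 rfl
  have hout : ∀ u ∈ K, ∀ v ∈ Q, v ∉ K → G.Adj u v → v = x := by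
    intro u hu v hv hvK huv
    by_contra hvx
    exact hvK (hKmax u hu v ⟨hv, hvx⟩ huv)
  obtain ⟨C, hCQ, hxC, hC, hCmax⟩ := exists_maximal_connected_induce (G := G) (Q := Q \ K)
    (z := x) ⟨hx, hxK⟩
  have hCeq : C = Q \ K := by
    refine hCQ.antisymm fun b hb => ?_
    by_contra hbC
    obtain ⟨u, -, hu, v, hvQ, hv, huv⟩ := exists_adj_of_connected_induce (K := C ∪ K) hQ hx
      (.inl hxC) hb.1 (by rintro (h | h); exacts [hbC h, hb.2 h])
    rw [Set.mem_union, not_or] at hv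
    rcases hu with hu | hu
    · exact hv.1 (hCmax u hu v ⟨hvQ, hv.2⟩ huv)
    · exact hv.1 (hout u hu v hvQ hv.2 huv ▸ hxC)
  obtain ⟨u, -, hu, v, hvQ, hv, huv⟩ := exists_adj_of_connected_induce hQ hz hzK hx hxK
  exact ⟨K, fun v hv => (hKQ hv).1, hxK, hK, hCeq ▸ hC, u, hu,
    hout u hu v hvQ hv huv ▸ huv.symm⟩

lemma HasClosureModel.exists_split_of_two_roots {N t d : ℕ} {S R Q Q' : Set V} {x : V}
    {D : Fin N → Set V} (hRS : R ⊆ S) (hDS : ∀ j, D j ⊆ S \ R)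
    (hD : Pairwise fun i j => Disjoint (D i) (D j)) (hQR : Q ⊆ R) (hQR' : Q' ⊆ R)
    (hQ : (G.induce Q).Connected) (hQ' : (G.induce Q').Connected) (hx : Q ∩ Q' ⊆ {x})
    {J J' : Finset (Fin N)} (hJ : 2 * t ≤ J.card) (hJ' : 2 * t ≤ J'.card)
    (hmodel : ∀ j ∈ J, HasClosureModel G t d (insert (openNbhd G Q) ∅) (D j))
    (hmodel' : ∀ j ∈ J', HasClosureModel G t d (insert (openNbhd G Q') ∅) (D j)) :
    ∃ S' ⊆ S, ∃ S'' ⊆ S, HasClosureModel G t (d + 1) ∅ S' ∧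
      HasClosureModel G t (d + 1) ∅ S'' ∧ ∃ x, S' ∩ S'' ⊆ {x} := by
  classical
  obtain ⟨I, hIJ, hI⟩ := Finset.exists_subset_card_eq (s := J) (n := t) (by omega)
  have hI' : t ≤ (J' \ I).card := by
    have := Finset.le_card_sdiff I J'
    omega
  have build : ∀ (P : Set V) (L : Finset (Fin N)), P ⊆ R → (G.induce P).Connected → t ≤ L.card →
      (∀ j ∈ L, HasClosureModel G t d (insert (openNbhd G P) ∅) (D j)) →
      P ∪ ⋃ j ∈ L, D j ⊆ S ∧ HasClosureModel G t (d + 1) ∅ (P ∪ ⋃ j ∈ L, D j) := by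
    intro P L hPR hP hL hLmodel
    refine ⟨Set.union_subset (hPR.trans hRS)
      (Set.iUnion₂_subset fun j _ => (hDS j).trans Set.sdiff_subset), ?_⟩
    refine .of_finset Set.subset_union_left hP (by simp) L hL (fun j hj v hv => ⟨.inr ?_, ?_⟩) hD
      hLmodel
    · exact Set.mem_biUnion (t := D) (Finset.mem_coe.2 hj) hv
    · exact fun h => (hDS j hv).2 (hPR h)
  obtain ⟨h₁, h₂⟩ := build Q I hQR hQ hI.ge fun j hj => hmodel j (hIJ hj)
  obtain ⟨h₁', h₂'⟩ := build Q' (J' \ I) hQR' hQ' hI' fun j hj =>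
    hmodel' j (Finset.mem_sdiff.1 hj).1
  refine ⟨_, h₁, _, h₁', h₂, h₂', x, ?_⟩
  rintro v ⟨hv | hv, hv' | hv'⟩
  · exact hx ⟨hv, hv'⟩
  · obtain ⟨j, hj, hvj⟩ := Set.mem_iUnion₂.1 hv'
    exact absurd (hQR hv) (hDS j hvj).2
  · obtain ⟨j, hj, hvj⟩ := Set.mem_iUnion₂.1 hv
    exact absurd (hQR' hv') (hDS j hvj).2
  · obtain ⟨j, hj, hvj⟩ := Set.mem_iUnion₂.1 hv
    obtain ⟨i, hi, hvi⟩ := Set.mem_iUnion₂.1 hv'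
    have hij : j ≠ i := fun h => (Finset.mem_sdiff.1 hi).2 (h ▸ hj)
    exact absurd hvi (Set.disjoint_left.1 (hD hij) hvj)

lemma HasClosureModel.exists_split [Finite V] {t d : ℕ} {S : Set V}
    (h : HasClosureModel G (6 * t + 3) (d + 1) ∅ S) :
    ∃ S' ⊆ S, ∃ S'' ⊆ S, HasClosureModel G t (d + 1) ∅ S' ∧
      HasClosureModel G t (d + 1) ∅ S'' ∧ ∃ x, S' ∩ S'' ⊆ {x} := by
  classical
  obtain ⟨R, hRS, hR, -, D, hDS, hD, hmodel⟩ := h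
  let J : Set V → Finset (Fin (6 * t + 3)) := fun Q => Finset.univ.filter fun j =>
    HasClosureModel G t d (insert (openNbhd G Q) ∅) (D j)
  have hJmodel : ∀ Q, ∀ j ∈ J Q, HasClosureModel G t d (insert (openNbhd G Q) ∅) (D j) :=
    fun Q j hj => (Finset.mem_filter.1 hj).2
  have hcover : ∀ P₁ P₂ P₃ : Set V, R ⊆ P₁ ∪ (P₂ ∪ P₃) →
      6 * t + 3 ≤ (J P₁).card + ((J P₂).card + (J P₃).card) := by
    intro P₁ P₂ P₃ hP
    have hsub : (Finset.univ : Finset (Fin (6 * t + 3))) ⊆ J P₁ ∪ (J P₂ ∪ J P₃) := by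
      intro j _
      have h₀ : HasClosureModel G (2 * (2 * t + 1) + 1) d
          (insert (openNbhd G P₁ ∪ openNbhd G (P₂ ∪ P₃)) ∅) (D j) := by
        refine (hmodel j).mono (by omega) ?_ subset_rfl
        rintro A (rfl | hA)
        · exact ⟨_, Set.mem_insert _ _, openNbhd_union (G := G) P₁ _ ▸ openNbhd_mono hP⟩
        · exact hA.elim
      simp only [Finset.mem_union, J, Finset.mem_filter, Finset.mem_univ, true_and]
      refine h₀.insert_left_or_insert_right.imp (fun h => h.mono_arity (by omega)) fun h => ?_
      rw [openNbhd_union] at h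
      exact h.insert_left_or_insert_right
    calc 6 * t + 3 = (Finset.univ : Finset (Fin (6 * t + 3))).card := by simp
      _ ≤ (J P₁ ∪ (J P₂ ∪ J P₃)).card := Finset.card_le_card hsub
      _ ≤ (J P₁).card + (J P₂ ∪ J P₃).card := Finset.card_union_le _ _
      _ ≤ _ := Nat.add_le_add_left (Finset.card_union_le _ _) _
  have main : ∀ m, ∀ Q ⊆ R, ∀ x ∈ Q, Q.ncard = m → (G.induce Q).Connected →
      (G.induce ((R \ Q) ∪ {x})).Connected → 2 * t ≤ (J Q).card →
      ∃ S' ⊆ S, ∃ S'' ⊆ S, HasClosureModel G t (d + 1) ∅ S' ∧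
        HasClosureModel G t (d + 1) ∅ S'' ∧ ∃ x, S' ∩ S'' ⊆ {x} := by
    intro m
    induction m using Nat.strong_induction_on with
    | _ m ih =>
      intro Q hQR x hx hm hQ hcompl hJQ
      by_cases hne : Q = {x}
      · exact exists_split_of_two_roots hRS hDS hD hQR hQR hQ hQ (x := x) (by simp [hne])
          hJQ hJQ (hJmodel Q) (hJmodel Q)
      obtain ⟨K, hKQ, hxK, hK, hQK, y, hy, hxy⟩ := exists_connected_split_s7 hQ hx hne
      have hKlt : K.ncard < m := hm ▸ Set.ncard_lt_ncard
        (hKQ.ssubset_of_mem_notMem hx hxK) (Set.toFinite _)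
      have hQKlt : (Q \ K).ncard < m := hm ▸ Set.ncard_lt_ncard
        (Set.sdiff_subset.ssubset_of_mem_notMem (hKQ hy) fun h => h.2 hy) (Set.toFinite _)
      by_cases hJK : 2 * t ≤ (J K).card
      · refine ih _ hKlt K (hKQ.trans hQR) y hy rfl hK ?_ hJK
        have h₁ : (G.induce (((R \ Q) ∪ {x}) ∪ (Q \ K))).Connected :=
          SimpleGraph.induce_union_connected hcompl.preconnected hQK.preconnected
            ⟨x, .inr rfl, hx, hxK⟩
        have h₂ := connected_induce_insert h₁ (.inr ⟨hx, hxK⟩) hxy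
        have heq : (R \ K) ∪ {y} = insert y (((R \ Q) ∪ {x}) ∪ (Q \ K)) := by
          ext v
          simp only [Set.mem_union, Set.mem_sdiff, Set.mem_singleton_iff, Set.mem_insert_iff]
          grind
        rwa [heq]
      by_cases hJQK : 2 * t ≤ (J (Q \ K)).card
      · refine ih _ hQKlt (Q \ K) (Set.sdiff_subset.trans hQR) x ⟨hx, hxK⟩ rfl hQK ?_ hJQK
        have h₁ : (G.induce (((R \ Q) ∪ {x}) ∪ K)).Connected :=
          SimpleGraph.connected_induce_union hcompl.preconnected hK.preconnected
            (.inr rfl) hy hxy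
        have heq : (R \ (Q \ K)) ∪ {x} = ((R \ Q) ∪ {x}) ∪ K := by
          ext v
          simp only [Set.mem_union, Set.mem_sdiff, Set.mem_singleton_iff]
          grind
        rwa [heq]
      have hc := hcover K (Q \ K) ((R \ Q) ∪ {x}) (by
        intro v hv
        simp only [Set.mem_union, Set.mem_sdiff, Set.mem_singleton_iff]
        tauto)
      refine exists_split_of_two_roots hRS hDS hD hQR
        (Set.union_subset Set.sdiff_subset (by simpa using hQR hx)) hQ hcompl (x := x) ?_ hJQ
        (J' := J ((R \ Q) ∪ {x})) (by omega) (hJmodel Q) (hJmodel _)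
      rintro v ⟨hv, hv' | hv'⟩
      exacts [absurd hv hv'.2, hv']
  obtain ⟨x, hx⟩ := hR.nonempty
  refine main _ R subset_rfl x hx rfl hR ?_ ?_
  · rw [Set.sdiff_self, Set.empty_union]
    exact connected_induce_singleton x
  · have : J R = Finset.univ := Finset.filter_true_of_mem fun j _ =>
      (hmodel j).mono_arity (by omega)
    rw [this]
    simp
    omega

end Splitting

section Colouring

variable {V : Type*} {G : SimpleGraph V}

lemma ClusteredColourableOn.mono {S S' : Set V} {q q' c c' : ℕ} (hS : S' ⊆ S) (hq : q ≤ q')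
    (hc : c ≤ c') (h : ClusteredColourableOn G S q c) : ClusteredColourableOn G S' q' c' := by
  obtain ⟨f, hf, hfc⟩ := h
  exact ⟨f, fun v hv => (hf v (hS hv)).trans_le hq,
    fun T hT hconn hmono => (hfc T (hT.trans hS) hconn hmono).trans hc⟩

lemma ClusteredColourableOn.union {S T : Set V} {p q c : ℕ} (hS : ClusteredColourableOn G S p c)
    (hT : ClusteredColourableOn G T q c) : ClusteredColourableOn G (S ∪ T) (p + q) c := by
  classical
  obtain ⟨f, hf, hfc⟩ := hS
  obtain ⟨g, hg, hgc⟩ := hT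
  refine ⟨fun v => if v ∈ S then f v else p + g v, ?_, fun U hU hconn hmono => ?_⟩
  · intro v hv
    by_cases hvS : v ∈ S
    · simpa [hvS] using Nat.lt_add_right q (hf v hvS)
    · simpa [hvS] using hg v (hv.resolve_left hvS)
  · by_cases hex : ∃ u ∈ U, u ∈ S
    · obtain ⟨u, huU, huS⟩ := hex
      have hUS : U ⊆ S := by
        intro v hv
        by_contra hvS
        have := hmono u huU v hv
        have := hf u huS
        simp only [huS, hvS, if_true, if_false] at *
        omega
      exact hfc U hUS hconn fun v hv w hw => by simpa [hUS hv, hUS hw] using hmono v hv w hw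
    · push Not at hex
      exact hgc U (fun v hv => (hU hv).resolve_left (hex v hv)) hconn fun v hv w hw => by
        simpa [hex v hv, hex w hw] using hmono v hv w hw

lemma ClusteredColourableOn.of_ncard_le [Finite V] {S : Set V} {c : ℕ} (h : S.ncard ≤ c) :
    ClusteredColourableOn G S 1 c :=
  ⟨fun _ => 0, fun _ _ => Nat.one_pos, fun _ hT _ _ =>
    (Set.ncard_le_ncard hT (Set.toFinite S)).trans h⟩

end Colouring

/-- Sets without a closure model of depth `d` are colourable with `q` colours and clustering
depending only on the arity. -/
def ModelFreeColourable (d q : ℕ) : Prop :=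
  ∀ k : ℕ, ∃ c : ℕ, ∀ (V : Type) [Finite V] (G : SimpleGraph V) (S : Set V),
    ¬ HasClosureModel G k d ∅ S → ClusteredColourableOn G S q c

/-- The set `L` contains `s` disjoint sets, each with a closure model. -/
def HasDisjointModels {V : Type*} (G : SimpleGraph V) (s n d : ℕ) (L : Set V) : Prop :=
  ∃ N : Fin s → Set V, (∀ j, N j ⊆ L) ∧ (Pairwise fun i j => Disjoint (N i) (N j)) ∧
    ∀ j, HasClosureModel G n d ∅ (N j)

lemma HasDisjointModels.cons {V : Type*} {G : SimpleGraph V} {s n d : ℕ} {L M : Set V}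
    {N : Fin s → Set V} (hN : ∀ j, N j ⊆ L) (hdisj : Pairwise fun i j => Disjoint (N i) (N j))
    (hmodel : ∀ j, HasClosureModel G n d ∅ (N j)) (hM : M ⊆ L) (hMN : ∀ j, Disjoint M (N j))
    (hMmodel : HasClosureModel G n d ∅ M) : HasDisjointModels G (s + 1) n d L := by
  refine ⟨Fin.cons M N, Fin.cases hM hN, ?_, Fin.cases hMmodel hmodel⟩
  intro i j hij
  cases i using Fin.cases with
  | zero =>
    cases j using Fin.cases with
    | zero => exact absurd rfl hij
    | succ j => simpa using hMN j
  | succ i =>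
    cases j using Fin.cases with
    | zero => simpa using (hMN i).symm
    | succ j => simpa using hdisj fun h => hij (congrArg Fin.succ h)

/-- The arities obtained from `k` by repeatedly undoing a split. -/
def splitArity (k : ℕ) : ℕ → ℕ
  | 0 => k
  | i + 1 => 6 * splitArity k i + 3

lemma splitArity_mono (k : ℕ) : Monotone (splitArity k) :=
  monotone_nat_of_le_succ fun i => by simp only [splitArity]; omega

lemma ModelFreeColourable.colourable_of_not_hasDisjointModels {d q : ℕ}
    (h : ModelFreeColourable (d + 1) q) (k : ℕ) :
    ∃ c : ℕ, 1 ≤ c ∧ ∀ (V : Type) [Finite V] (G : SimpleGraph V) (L : Set V),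
      ¬ HasDisjointModels G k k (d + 1) L → ClusteredColourableOn G L (2 * q + 1) c := by
  classical
  obtain ⟨c, hc⟩ := h (splitArity k k)
  refine ⟨max 1 (max c k), le_max_left _ _, fun V _ G L hL => ?_⟩
  obtain ⟨s, hsk, ⟨N, hNL, hNdisj, hN⟩, hs⟩ : ∃ s < k,
      HasDisjointModels G s (splitArity k (k - s)) (d + 1) L ∧
      ¬ HasDisjointModels G (s + 1) (splitArity k (k - (s + 1))) (d + 1) L := by
    by_contra! hcon
    have hall : ∀ s ≤ k, HasDisjointModels G s (splitArity k (k - s)) (d + 1) L := by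
      intro s
      induction s with
      | zero => exact fun _ => ⟨Fin.elim0, fun j => j.elim0, fun j => j.elim0, fun j => j.elim0⟩
      | succ s ih => exact fun hs => hcon s hs (ih (by omega))
    have := hall k le_rfl
    rw [Nat.sub_self] at this
    exact hL this
  set t := splitArity k (k - (s + 1)) with ht
  have hsucc : splitArity k (k - s) = 6 * t + 3 := by
    rw [ht, show k - s = k - (s + 1) + 1 by omega, splitArity]
  have htk : t ≤ splitArity k k := splitArity_mono k (Nat.sub_le _ _)
  have hcol : ∀ M : Set V, ¬ HasClosureModel G t (d + 1) ∅ M →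
      ClusteredColourableOn G M q (max 1 (max c k)) := fun M hM =>
    (hc V G M fun hM' => hM (hM'.mono_arity htk)).mono subset_rfl le_rfl (by omega)
  have hsplit := fun j =>
    (hsucc ▸ hN j : HasClosureModel G (6 * t + 3) (d + 1) ∅ (N j)).exists_split
  choose N' hN' N'' hN'' hmodel' hmodel'' x hx using hsplit
  have hdisj' : Pairwise fun i j => Disjoint (N' i) (N' j) :=
    fun i j hij => (hNdisj hij).mono (hN' i) (hN' j)
  have hdisj'' : Pairwise fun i j => Disjoint (N'' i) (N'' j) :=
    fun i j hij => (hNdisj hij).mono (hN'' i) (hN'' j)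
  set Z := ⋃ j, N' j
  set X := ⋃ j, N' j ∩ N'' j
  have hX_card : X.ncard ≤ k := by
    have hsub : X ⊆ ((Finset.univ.image x : Finset V) : Set V) := by
      refine Set.iUnion_subset fun j v hv => ?_
      simpa using ⟨j, (hx j hv).symm⟩
    calc X.ncard ≤ _ := Set.ncard_le_ncard hsub (Set.toFinite _)
      _ = (Finset.univ.image x).card := Set.ncard_coe_finset _
      _ ≤ s := Finset.card_image_le.trans (by simp)
      _ ≤ k := hsk.le
  have hZL : Z ⊆ L := Set.iUnion_subset fun j => (hN' j).trans (hNL j)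
  have hout : ¬ HasClosureModel G t (d + 1) ∅ (L \ Z) := fun hM =>
    hs (.cons (fun j => (hN' j).trans (hNL j)) hdisj' hmodel' Set.sdiff_subset
      (fun j => Set.disjoint_left.2 fun v hv hv' => hv.2 (Set.mem_iUnion.2 ⟨j, hv'⟩)) hM)
  have hin : ¬ HasClosureModel G t (d + 1) ∅ (Z \ X) := by
    refine fun hM => hs (.cons (fun j => (hN'' j).trans (hNL j)) hdisj'' hmodel''
      (Set.sdiff_subset.trans hZL) (fun j => Set.disjoint_left.2 fun v hv hv' => hv.2 ?_) hM)
    obtain ⟨i, hi⟩ := Set.mem_iUnion.1 hv.1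
    obtain rfl : i = j := by
      by_contra hij
      exact Set.disjoint_left.1 (hNdisj hij) (hN' i hi) (hN'' j hv')
    exact Set.mem_iUnion.2 ⟨i, hi, hv'⟩
  refine ((hcol _ hout).union ((hcol _ hin).union
    (ClusteredColourableOn.of_ncard_le (S := X) (by omega)))).mono
      (fun v hv => ?_) (by omega) le_rfl
  by_cases hvZ : v ∈ Z <;> by_cases hvX : v ∈ X <;> simp [hv, hvZ, hvX]

lemma ModelFreeColourable.one_zero : ModelFreeColourable 1 0 := by
  refine fun k => ⟨0, fun V _ G S hS => ?_⟩
  have hempty : S = ∅ := by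
    by_contra hne
    obtain ⟨v, hv⟩ := Set.nonempty_iff_ne_empty.2 hne
    exact hS ⟨{v}, by simpa using hv, connected_induce_singleton v, by simp, fun _ => ∅, by simp,
      fun _ _ _ => by simp, fun _ => trivial⟩
  subst hempty
  exact ⟨fun _ => 0, by simp, fun T hT _ _ => by simp [Set.subset_empty_iff.1 hT]⟩

section Layers

variable {V : Type*} (Γ : SimpleGraph V)

/-- The distance of `v` from a fixed representative of its connected component. -/
noncomputable def level (v : V) : ℕ :=
  Γ.dist (Γ.connectedComponentMk v).out v

variable {Γ}

lemma reachable_out (v : V) : Γ.Reachable (Γ.connectedComponentMk v).out v :=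
  SimpleGraph.ConnectedComponent.exact (Quot.out_eq _)

lemma level_eq_zero_iff {v : V} : level Γ v = 0 ↔ (Γ.connectedComponentMk v).out = v :=
  (reachable_out v).dist_eq_zero_iff

lemma level_le_succ_of_adj {u v : V} (h : Γ.Adj u v) : level Γ v ≤ level Γ u + 1 := by
  have hcomp := SimpleGraph.ConnectedComponent.sound h.reachable
  obtain ⟨p, hp⟩ := (reachable_out (Γ := Γ) u).exists_walk_length_eq_dist
  rw [level, level, ← hcomp, ← hp, ← SimpleGraph.Walk.length_concat p h]
  exact SimpleGraph.dist_le _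

lemma exists_adj_level_eq {v : V} {n : ℕ} (h : level Γ v = n + 1) :
    ∃ w, Γ.Adj w v ∧ level Γ w = n := by
  obtain ⟨p, hp⟩ := (reachable_out (Γ := Γ) v).symm.exists_walk_length_eq_dist
  rw [SimpleGraph.dist_comm, ← level, h] at hp
  generalize hr : (Γ.connectedComponentMk v).out = r at p
  cases p with
  | nil => simp at hp
  | @cons _ w _ hvw q =>
    refine ⟨w, hvw.symm, ?_⟩
    have h₁ := level_le_succ_of_adj hvw.symm
    have h₂ : level Γ w ≤ n := by
      rw [level, ← SimpleGraph.ConnectedComponent.sound hvw.reachable, hr, SimpleGraph.dist_comm]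
      rw [SimpleGraph.Walk.length_cons] at hp
      exact (SimpleGraph.dist_le q).trans (by omega)
    omega

end Layers

/-- The graph `G` with only the edges inside `S` kept. -/
def restrictTo {V : Type*} (G : SimpleGraph V) (S : Set V) : SimpleGraph V where
  Adj u v := G.Adj u v ∧ u ∈ S ∧ v ∈ S
  symm := ⟨fun _ _ h => ⟨h.1.symm, h.2.2, h.2.1⟩⟩
  loopless := ⟨fun _ h => h.1.ne rfl⟩

/-- The vertices of `S` at distance `i` from the representative of the component `C`. -/
def layer {V : Type*} (G : SimpleGraph V) (S : Set V) (C : (restrictTo G S).ConnectedComponent)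
    (i : ℕ) : Set V :=
  {v | v ∈ S ∧ (restrictTo G S).connectedComponentMk v = C ∧ level (restrictTo G S) v = i}

section Layers

variable {V : Type*} {G : SimpleGraph V} {S : Set V}

lemma subset_layer_of_connected {T : Set V} (hTS : T ⊆ S) (hT : (G.induce T).Connected)
    (hpar : ∀ u ∈ T, ∀ v ∈ T,
      level (restrictTo G S) u % 2 = level (restrictTo G S) v % 2) {v : V} (hv : v ∈ T) :
    T ⊆ layer G S ((restrictTo G S).connectedComponentMk v) (level (restrictTo G S) v) := by
  intro b hb
  by_contra hbK
  obtain ⟨u, hu, ⟨-, hu₁, hu₂⟩, w, hw, hwK, huw⟩ := exists_adj_of_connected_induce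
    (K := layer G S _ _) hT hv ⟨hTS hv, rfl, rfl⟩ hb hbK
  have hadj : (restrictTo G S).Adj u w := ⟨huw, hTS hu, hTS hw⟩
  refine hwK ⟨hTS hw, ?_, ?_⟩
  · rw [← hu₁]
    exact (SimpleGraph.ConnectedComponent.sound hadj.reachable).symm
  · have h₁ := level_le_succ_of_adj hadj
    have h₂ := level_le_succ_of_adj hadj.symm
    have h₃ := hpar u hu w hw
    omega

lemma exists_mem_layer_adj {C : (restrictTo G S).ConnectedComponent} {n : ℕ} {v : V}
    (hv : v ∈ layer G S C (n + 1)) : ∃ w ∈ layer G S C n, G.Adj w v := by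
  obtain ⟨-, hv₁, hv₂⟩ := hv
  obtain ⟨w, hwv, hw⟩ := exists_adj_level_eq hv₂
  exact ⟨w, ⟨hwv.2.1, hv₁ ▸ SimpleGraph.ConnectedComponent.sound hwv.reachable, hw⟩, hwv.1⟩

lemma layer_zero_subset (C : (restrictTo G S).ConnectedComponent) : layer G S C 0 ⊆ {C.out} := by
  rintro v ⟨-, rfl, hv⟩
  exact (level_eq_zero_iff.1 hv).symm

lemma connected_iUnion_layer {C : (restrictTo G S).ConnectedComponent} (n : ℕ)
    (hne : (layer G S C n).Nonempty) : (G.induce (⋃ m ≤ n, layer G S C m)).Connected := by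
  have hpatch : ∀ m ≤ n, ∀ v ∈ layer G S C m, ∃ P ⊆ ⋃ m ≤ n, layer G S C m,
      C.out ∈ P ∧ v ∈ P ∧ (G.induce P).Connected := by
    intro m
    induction m with
    | zero =>
      intro hm v hv
      obtain rfl := layer_zero_subset C hv
      exact ⟨{C.out}, by simpa using ⟨0, hm, hv⟩, rfl, rfl, connected_induce_singleton _⟩
    | succ m ih =>
      intro hm v hv
      obtain ⟨w, hw, hwv⟩ := exists_mem_layer_adj hv
      obtain ⟨P, hP, hout, hwP, hconn⟩ := ih (by omega) w hw
      exact ⟨insert v P, Set.insert_subset (Set.mem_iUnion₂.2 ⟨m + 1, hm, hv⟩) hP, .inr hout,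
        .inl rfl, connected_induce_insert hconn hwP hwv⟩
  obtain ⟨v, hv⟩ := hne
  obtain ⟨P, hP, hout, -⟩ := hpatch n le_rfl v hv
  refine SimpleGraph.induce_connected_of_patches C.out (hP hout) fun {v} hv => ?_
  obtain ⟨m, hm, hv⟩ := Set.mem_iUnion₂.1 hv
  obtain ⟨P, hP, hout, hvP, hconn⟩ := hpatch m hm v hv
  exact ⟨P, hP, hout, hvP, hconn.preconnected _ _⟩

lemma HasDisjointModels.hasClosureModel_of_layer {k d n : ℕ}
    {C : (restrictTo G S).ConnectedComponent} (hne : (layer G S C (n + 1)).Nonempty)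
    (h : HasDisjointModels G k k d (layer G S C (n + 1))) : HasClosureModel G k (d + 1) ∅ S := by
  obtain ⟨N, hN, hdisj, hmodel⟩ := h
  obtain ⟨v, hv⟩ := hne
  obtain ⟨w, hw, -⟩ := exists_mem_layer_adj hv
  refine ⟨⋃ m ≤ n, layer G S C m, Set.iUnion₂_subset fun m _ v hv => hv.1,
    connected_iUnion_layer n ⟨w, hw⟩, by simp, N, fun j v hv => ⟨(hN j hv).1, fun hv' => ?_⟩,
    hdisj, fun j => (hmodel j).insert_of_subset fun v hv => ?_⟩
  · obtain ⟨m, hm, hvm⟩ := Set.mem_iUnion₂.1 hv'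
    have h₁ := (hN j hv).2.2
    have h₂ := hvm.2.2
    omega
  · obtain ⟨w, hw, hwv⟩ := exists_mem_layer_adj (hN j hv)
    exact ⟨w, Set.mem_iUnion₂.2 ⟨n, le_rfl, hw⟩, hwv⟩

lemma ClusteredColourableOn.of_layers {q c : ℕ}
    (h : ∀ C i, ClusteredColourableOn G (layer G S C i) q c) :
    ClusteredColourableOn G S (2 * q) c := by
  choose g hg hgc using h
  refine ⟨fun v => 2 * g ((restrictTo G S).connectedComponentMk v) (level (restrictTo G S) v) v +
    level (restrictTo G S) v % 2, fun v hv => ?_, fun T hTS hT hmono => ?_⟩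
  · have := hg _ _ v ⟨hv, rfl, rfl⟩
    dsimp only
    omega
  · obtain ⟨v, hv⟩ := hT.nonempty
    have hTL := subset_layer_of_connected hTS hT (fun u hu w hw => by
      have := hmono u hu w hw
      dsimp only at this
      omega) hv
    refine hgc _ _ T hTL hT fun u hu w hw => ?_
    have := hmono u hu w hw
    simp only [(hTL hu).2.1, (hTL hu).2.2, (hTL hw).2.1, (hTL hw).2.2] at this
    omega

end Layers

lemma ModelFreeColourable.succ {d q : ℕ} (h : ModelFreeColourable (d + 1) q) :
    ModelFreeColourable (d + 2) (4 * q + 2) := by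
  intro k
  obtain ⟨c, hc, hcol⟩ := h.colourable_of_not_hasDisjointModels k
  refine ⟨c, fun V _ G S hS => ?_⟩
  rw [show 4 * q + 2 = 2 * (2 * q + 1) by omega]
  refine .of_layers fun C i => ?_
  rcases (layer G S C i).eq_empty_or_nonempty with he | hne
  · exact (ClusteredColourableOn.of_ncard_le (by simp [he])).mono subset_rfl (by omega) le_rfl
  cases i with
  | zero =>
    refine (ClusteredColourableOn.of_ncard_le ?_).mono subset_rfl (by omega) le_rfl
    calc _ ≤ _ := Set.ncard_le_ncard (layer_zero_subset C) (Set.toFinite _)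
      _ ≤ c := by simpa using hc
  | succ n => exact hcol V G _ fun hmodels => hS (hmodels.hasClosureModel_of_layer hne)

lemma modelFreeColourable (d : ℕ) : ModelFreeColourable (d + 1) ((4 ^ (d + 1) - 4) / 6) := by
  induction d with
  | zero => exact .one_zero
  | succ d ih =>
    have hmod : 4 ^ (d + 1) % 6 = 4 := by
      clear ih
      induction d with
      | zero => rfl
      | succ d ih => rw [pow_succ]; omega
    have hpow : 4 ^ (d + 2) = 4 * 4 ^ (d + 1) := by ring
    rw [show (4 ^ (d + 2) - 4) / 6 = 4 * ((4 ^ (d + 1) - 4) / 6) + 2 by omega]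
    exact ih.succ

lemma HasClosureModel.exists_branchSets {V : Type*} {G : SimpleGraph V} {n d : ℕ}
    {𝓡 : Set (Set V)} {S : Set V} (h : HasClosureModel G n d 𝓡 S) :
    ∃ X : List (Fin n) → Set V,
      (∀ l, l.length < d → X l ⊆ S ∧ (G.induce (X l)).Connected ∧ ∀ A ∈ 𝓡, (X l ∩ A).Nonempty) ∧
      (∀ l l', l.length < d → l'.length < d → l ≠ l' → Disjoint (X l) (X l')) ∧
      ∀ l l', l'.length < d → l <+: l' → l ≠ l' → ∃ x ∈ X l, ∃ y ∈ X l', G.Adj x y := by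
  induction d generalizing 𝓡 S with
  | zero => exact ⟨fun _ => ∅, by simp, by simp, by simp⟩
  | succ d ih =>
    obtain ⟨R, hRS, hR, hmeet, D, hDS, hD, hmodel⟩ := h
    choose Y hY hYdisj hYadj using fun j => ih (hmodel j)
    have hRY : ∀ j l, l.length < d → Disjoint R (Y j l) := fun j l hl =>
      Set.disjoint_left.2 fun v hv hv' => (hDS j ((hY j l hl).1 hv')).2 hv
    refine ⟨fun l => l.casesOn R Y, ?_, ?_, ?_⟩
    · rintro (_ | ⟨j, l⟩) hl
      · exact ⟨hRS, hR, hmeet⟩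
      · obtain ⟨h₁, h₂, h₃⟩ := hY j l (by simpa using hl)
        exact ⟨h₁.trans ((hDS j).trans Set.sdiff_subset), h₂, fun A hA => h₃ A (.inr hA)⟩
    · rintro (_ | ⟨j, l⟩) (_ | ⟨j', l'⟩) hl hl' hne
      · exact absurd rfl hne
      · exact hRY j' l' (by simpa using hl')
      · exact (hRY j l (by simpa using hl)).symm
      · have hl₀ : l.length < d := by simpa using hl
        have hl₀' : l'.length < d := by simpa using hl'
        by_cases hj : j = j'
        · subst hj
          exact hYdisj j l l' hl₀ hl₀' fun h => hne (h ▸ rfl)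
        · exact (hD hj).mono (hY j l hl₀).1 (hY j' l' hl₀').1
    · rintro (_ | ⟨j, l⟩) (_ | ⟨j', l'⟩) hl' hpre hne
      · exact absurd rfl hne
      · obtain ⟨y, hy, x, hx, hxy⟩ := (hY j' l' (by simpa using hl')).2.2 _ (.inl rfl)
        exact ⟨x, hx, y, hy, hxy⟩
      · simp at hpre
      · obtain ⟨rfl, hpre'⟩ := List.cons_prefix_cons.1 hpre
        exact hYadj j l l' (by simpa using hl') hpre' fun h => hne (h ▸ rfl)

lemma HasClosureModel.isMinor_closureTree {V : Type*} {G : SimpleGraph V} {n d : ℕ} {S : Set V}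
    (h : HasClosureModel G n d ∅ S) : IsMinor (closureTree d n) G := by
  obtain ⟨X, hX, hdisj, hadj⟩ := h.exists_branchSets
  refine ⟨fun l => X l.1, fun l => (hX l.1 l.2).2.1,
    fun l l' hne => hdisj _ _ l.2 l'.2 fun h => hne (Subtype.ext h), fun l l' hll' => ?_⟩
  obtain ⟨hne, hpre | hpre⟩ := (SimpleGraph.fromRel_adj _ _ _).1 hll'
  · exact hadj _ _ l'.2 hpre fun h => hne (Subtype.ext h)
  · obtain ⟨y, hy, x, hx, hyx⟩ := hadj _ _ l.2 hpre fun h => hne (Subtype.ext h.symm)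
    exact ⟨x, hx, y, hy, hyx.symm⟩

lemma IsSubgraphEmb.isMinor {α β γ : Type*} {H : SimpleGraph α} {K : SimpleGraph β}
    {G : SimpleGraph γ} (hHK : IsSubgraphEmb H K) (hKG : IsMinor K G) : IsMinor H G := by
  obtain ⟨f, hf, hfadj⟩ := hHK
  obtain ⟨X, hX, hdisj, hadj⟩ := hKG
  exact ⟨fun a => X (f a), fun a => hX _, fun a b hab => hdisj (hf.ne hab),
    fun a b hab => hadj _ _ (hfadj a b hab)⟩

lemma isSubgraphEmb_closureTree_ctd {U : Type*} [Finite U] (H : SimpleGraph U) :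
    IsSubgraphEmb H (closureTree (ctd H) (Nat.card U)) := by
  refine Nat.sInf_mem (s := {h | IsSubgraphEmb H (closureTree h (Nat.card U))})
    ⟨Nat.card U, ?_⟩
  let e := Finite.equivFin U
  let path : U → List (Fin (Nat.card U)) := fun u =>
    List.replicate (e u : ℕ) ⟨0, (e u).pos⟩
  have hinj : ∀ a b, path a = path b → a = b := fun a b hab => by
    have := congrArg List.length hab
    simp only [path, List.length_replicate] at this
    exact e.injective (Fin.ext this)
  have hpre : ∀ a b, (e a : ℕ) ≤ e b → path a <+: path b := fun a b hab => by
    refine ⟨List.replicate ((e b : ℕ) - e a) ⟨0, (e a).pos⟩, ?_⟩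
    simp only [path, List.replicate_append_replicate]
    congr 1
    omega
  refine ⟨fun u => ⟨path u, by simp [path]⟩, fun a b hab => hinj a b (congrArg Subtype.val hab),
    fun a b hab => (SimpleGraph.fromRel_adj _ _ _).2
      ⟨fun h => hab.ne (hinj a b (congrArg Subtype.val h)), ?_⟩⟩
  exact (le_total (e a : ℕ) (e b)).imp (hpre a b) (hpre b a)

lemma ClusteredColourableOn.clusteredColourable {V : Type*} {G : SimpleGraph V}
    {q c : ℕ} (h : ClusteredColourableOn G Set.univ q c) : ClusteredColourable G q c := by
  obtain ⟨f, hf, hfc⟩ := h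
  refine ⟨fun v => ⟨f v, hf v trivial⟩, fun v => ?_⟩
  set Γ := G.induce {u | (⟨f u, hf u trivial⟩ : Fin q) = ⟨f v, hf v trivial⟩}
  set C := Γ.connectedComponentMk ⟨v, rfl⟩
  have hcol : ∀ u ∈ Subtype.val '' C.supp, f u = f v := by
    rintro _ ⟨u, -, rfl⟩
    exact congrArg Fin.val u.2
  rw [← Set.ncard_image_of_injective _ Subtype.val_injective]
  refine hfc _ (Set.subset_univ _) ?_ fun u hu w hw => (hcol u hu).trans (hcol w hw).symm
  let φ : C.toSimpleGraph →g G.induce (Subtype.val '' C.supp) :=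
    ⟨fun u => ⟨u.1.1, Set.mem_image_of_mem _ u.2⟩, fun h => h⟩
  refine C.connected_toSimpleGraph.map φ ?_
  rintro ⟨_, u, hu, rfl⟩
  exact ⟨⟨u, hu⟩, rfl⟩

/-- For every graph `H` there is an integer `c = c(H) ≥ 1` such that
every `H`-minor-free graph is `((4^{ctd(H)} - 4)/6)`-colourable with clustering `c`. -/
theorem clustered_colouring_minor_free_four_pow_bound
    {U : Type} [Finite U] (H : SimpleGraph U) :
    ∃ c : ℕ, 1 ≤ c ∧ ∀ (V : Type) [Finite V] (G : SimpleGraph V),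
      ¬ IsMinor H G → ClusteredColourable G ((4 ^ ctd H - 4) / 6) c := by
  have hemb := isSubgraphEmb_closureTree_ctd H
  cases hd : ctd H with
  | zero =>
    obtain ⟨f, -⟩ := hd ▸ hemb
    have : IsEmpty U := ⟨fun u => Nat.not_lt_zero _ (f u).2⟩
    exact ⟨1, le_rfl, fun V _ G hG => absurd
      ⟨isEmptyElim, isEmptyElim, fun a => isEmptyElim a, isEmptyElim⟩ hG⟩
  | succ d =>
    obtain ⟨c, hc⟩ := modelFreeColourable d (Nat.card U)
    refine ⟨max 1 c, le_max_left _ _, fun V _ G hG => ?_⟩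
    refine ((hc V G Set.univ fun hmodel => hG ?_).mono subset_rfl le_rfl
      (le_max_right _ _)).clusteredColourable
    exact (hd ▸ hemb).isMinor hmodel.isMinor_closureTree
end
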